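/- arXiv:0908.3462 — 5 statements merged into one kernel-verified Lean document; each statement's English description precedes it below -/
import Mathlib

section
/- Let n ≥ 2 and a ≥ 2 be integers, set α = 1 - 1/a, and for 1 ≤ i ≤ n define Q_a(i) = a^{-n} Σ_{k=1}^{a} (k-1)^{n-i} k^{i-1} (with 0^0 = 1). Then the total variation distance TV(a) = (1/2) Σ_{i=1}^{n} |Q_a(i) - 1/n| is at most α^{n+1}/(1-α^n) - a·α^2·(1-α^{n-1})/(n(1-α^n)) + (1/(n·log(1/α)))·log((a/n)·(1-α^n)/α^{n+1}), and at least α^n/(1-α^{n-1}) - a·(1-α^n)/(n·α·(1-α^{n-1})) + (1/(n·log(1/α)))·log((a/n)·(1-α^{n-1})/α^{n-1}). -/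
/-- Key Jensen-type inequality. -/
lemma aux_jensen (b : ℝ) (hb : 1 ≤ b) (N : ℕ) :
    b * (b / (b + 1)) ^ N ≤ 1 + (b - 1) * ((b - 1) / b) ^ N := by
  have hb0 : 0 < b := by linarith
  have hconv : ConvexOn ℝ (Set.Ici 0) fun x : ℝ => x ^ N := convexOn_pow N
  have hc := hconv.2 (show (1 : ℝ) ∈ Set.Ici 0 by simp)
    (show (b - 1) / b ∈ Set.Ici 0 by simp only [Set.mem_Ici]; apply div_nonneg <;> linarith)
    (show 0 ≤ 1 / b by positivity) (show 0 ≤ (b - 1) / b by apply div_nonneg <;> linarith)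
    (by field_simp; ring)
  simp only [smul_eq_mul, one_pow, mul_one] at hc
  have hm : b / (b + 1) ≤ 1 / b + (b - 1) / b * ((b - 1) / b) := by
    have : 1 / b + (b - 1) / b * ((b - 1) / b) - b / (b + 1) = 1 / (b ^ 2 * (b + 1)) := by
      field_simp; ring
    have h2 : 0 ≤ 1 / (b ^ 2 * (b + 1)) := by positivity
    linarith
  have hp : (b / (b + 1)) ^ N ≤ 1 / b + (b - 1) / b * ((b - 1) / b) ^ N :=
    (pow_le_pow_left₀ (by positivity) hm N).trans hc
  calc b * (b / (b + 1)) ^ N ≤ b * (1 / b + (b - 1) / b * ((b - 1) / b) ^ N) := by gcongr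
    _ = _ := by field_simp

/-- Lower bound for power sums. -/
lemma aux_sum (N a : ℕ) (ha : 1 ≤ a) :
    (a : ℝ) ^ (N + 1) * ((a : ℝ) + 1) ^ N ≤
      (((a : ℝ) + 1) ^ (N + 1) - (a : ℝ) ^ (N + 1)) * ∑ k ∈ Finset.Icc 1 a, (k : ℝ) ^ N := by
  induction a, ha using Nat.le_induction with
  | base =>
    simp
    have : (1 : ℝ) ≤ (1 + 1) ^ N := one_le_pow₀ (by norm_num)
    rw [pow_succ]; linarith
  | succ a ha ih =>
    rw [Finset.sum_Icc_succ_top (by omega)]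
    push_cast
    set S := ∑ k ∈ Finset.Icc 1 a, (k : ℝ) ^ N with hS
    have ha' : (1 : ℝ) ≤ a := by exact_mod_cast ha
    set b : ℝ := (a : ℝ) + 1 with hb
    have hab : (a : ℝ) = b - 1 := by rw [hb]; ring
    rw [hab] at ih
    have hb1 : 1 ≤ b := by linarith
    have hb0 : 0 < b := by linarith
    have hj := aux_jensen b hb1 N
    have hbp : 0 < b ^ N := by positivity
    have hcp : 0 < (b + 1) ^ N := by positivity
    -- b^(N+1) b^N ≤ b^N (b+1)^N + (b-1)^(N+1) (b+1)^N
    have hj' : b ^ (N + 1) * b ^ N ≤ b ^ N * (b + 1) ^ N + (b - 1) ^ (N + 1) * (b + 1) ^ N := by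
      have := mul_le_mul_of_nonneg_right hj (mul_pos hbp hcp).le
      rw [div_pow, div_pow] at this
      have e1 : b * (b ^ N / (b + 1) ^ N) * (b ^ N * (b + 1) ^ N) = b ^ (N + 1) * b ^ N := by
        field_simp; ring
      have e2 : (1 + (b - 1) * ((b - 1) ^ N / b ^ N)) * (b ^ N * (b + 1) ^ N) =
          b ^ N * (b + 1) ^ N + (b - 1) ^ (N + 1) * (b + 1) ^ N := by
        field_simp; ring
      linarith
    have hD : 0 < b ^ (N + 1) - (b - 1) ^ (N + 1) := by
      have := pow_lt_pow_left₀ (show b - 1 < b by linarith) (by linarith) (n := N + 1) (by omega)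
      linarith
    have hE : 0 < (b + 1) ^ (N + 1) - b ^ (N + 1) := by
      have := pow_lt_pow_left₀ (show b < b + 1 by linarith) (by linarith) (n := N + 1) (by omega)
      linarith
    have h1 : b ^ (N + 1) * b ^ N ≤ (b ^ (N + 1) - (b - 1) ^ (N + 1)) * (S + b ^ N) := by
      nlinarith
    have h2 : (b + 1) ^ N * (b ^ (N + 1) - (b - 1) ^ (N + 1)) ≤
        b ^ N * ((b + 1) ^ (N + 1) - b ^ (N + 1)) := by
      rw [pow_succ (b + 1) N, pow_succ b N] at *
      nlinarith
    refine le_of_mul_le_mul_left ?_ hD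
    calc (b ^ (N + 1) - (b - 1) ^ (N + 1)) * (b ^ (N + 1) * (b + 1) ^ N)
        = b ^ (N + 1) * ((b + 1) ^ N * (b ^ (N + 1) - (b - 1) ^ (N + 1))) := by ring
      _ ≤ b ^ (N + 1) * (b ^ N * ((b + 1) ^ (N + 1) - b ^ (N + 1))) := by gcongr
      _ = ((b + 1) ^ (N + 1) - b ^ (N + 1)) * (b ^ (N + 1) * b ^ N) := by ring
      _ ≤ ((b + 1) ^ (N + 1) - b ^ (N + 1)) *
          ((b ^ (N + 1) - (b - 1) ^ (N + 1)) * (S + b ^ N)) := by gcongr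
      _ = _ := by ring

lemma aux_pos_part (f : ℕ → ℝ) (n : ℕ) (hf : ∀ i j, 1 ≤ i → i ≤ j → j ≤ n → f j ≤ f i) :
    ∃ m ≤ n, ∑ i ∈ Finset.Icc 1 n, max (f i) 0 = ∑ i ∈ Finset.Icc 1 m, f i := by
  induction n with
  | zero => exact ⟨0, le_rfl, by simp⟩
  | succ n ih =>
    by_cases h : 0 ≤ f (n + 1)
    · refine ⟨n + 1, le_rfl, Finset.sum_congr rfl fun i hi => ?_⟩
      rw [Finset.mem_Icc] at hi
      exact max_eq_left (h.trans (hf i (n + 1) hi.1 hi.2 le_rfl))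
    · obtain ⟨m, hm, e⟩ := ih fun i j h1 h2 h3 => hf i j h1 h2 (by omega)
      refine ⟨m, by omega, ?_⟩
      rw [Finset.sum_Icc_succ_top (by omega), e, max_eq_right (by linarith), add_zero]

lemma aux_geom (α c : ℝ) (h1 : α ≠ 1) (N m : ℕ) (hm : m ≤ N) :
    ∑ i ∈ Finset.Icc 1 m, α ^ (N - i) * c = (α ^ (N - m) - α ^ N) * c / (1 - α) := by
  have h1' : 1 - α ≠ 0 := sub_ne_zero.mpr h1.symm
  induction m with
  | zero => simp
  | succ m ih =>
    rw [Finset.sum_Icc_succ_top (by omega), ih (by omega)]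
    have : N - m = (N - (m + 1)) + 1 := by omega
    rw [this, pow_succ]
    field_simp
    ring

lemma aux_inner (x y : ℝ) (n : ℕ) :
    (∑ i ∈ Finset.Icc 1 n, x ^ (n - i) * y ^ (i - 1)) * (y - x) = y ^ n - x ^ n := by
  have h := (Commute.all y x).geom_sum₂_mul n
  rw [← h]
  congr 1
  have e := Finset.sum_Ico_add' (fun i => x ^ (n - i) * y ^ (i - 1)) 0 n 1
  rw [Finset.range_eq_Ico]
  refine Eq.trans (?_ : _ = _) (e.symm.trans ?_)
  · rfl
  · refine Finset.sum_congr rfl fun i _ => ?_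
    rw [mul_comm, Nat.add_sub_cancel, Nat.sub_sub, Nat.add_comm 1 i]

lemma aux_tele (n a : ℕ) (hn : n ≠ 0) : ∑ k ∈ Finset.Icc 1 a, ((k : ℝ) ^ n - ((k : ℝ) - 1) ^ n) = (a : ℝ) ^ n := by
  induction a with
  | zero => simp [hn]
  | succ a ih =>
    rw [Finset.sum_Icc_succ_top (by omega), ih]; push_cast; ring

lemma aux_log (α a : ℝ) (h0 : 0 < α) (h1 : α < 1) (haα : a * (1 - α) = 1) :
    0 < Real.log (1 / α) ∧ a * α ≤ 1 / Real.log (1 / α) ∧ 1 / Real.log (1 / α) ≤ a := by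
  have ha : 0 < a := by
    by_contra h
    nlinarith
  have e : Real.log (1 / α) = -Real.log α := by rw [one_div, Real.log_inv]
  have l1 : 1 - α ≤ Real.log (1 / α) := by
    have := Real.log_le_sub_one_of_pos h0
    linarith
  have l2 : Real.log (1 / α) ≤ 1 / α - 1 := Real.log_le_sub_one_of_pos (by positivity)
  have hpos : 0 < Real.log (1 / α) := by linarith
  refine ⟨hpos, ?_, ?_⟩
  · rw [le_div_iff₀ hpos]
    calc a * α * Real.log (1 / α) ≤ a * α * (1 / α - 1) := by gcongr
      _ = a * (1 - α) := by field_simp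
      _ = 1 := haα
  · rw [div_le_iff₀ hpos]
    nlinarith

lemma aux_upper (α a : ℝ) (n m : ℕ) (hn : 2 ≤ n) (hm : m ≤ n) (h0 : 0 < α) (h1 : α < 1)
    (haα : a * (1 - α) = 1) :
    (m : ℝ) / n - (α ^ (n + 1 - m) - α ^ (n + 1)) / (1 - α ^ n) ≤
      α ^ (n + 1) / (1 - α ^ n) - a * α ^ 2 * (1 - α ^ (n - 1)) / ((n : ℝ) * (1 - α ^ n)) +
        (1 / ((n : ℝ) * Real.log (1 / α))) *
          Real.log ((a / n) * (1 - α ^ n) / α ^ (n + 1)) := by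
  obtain ⟨hl, hy1, hy2⟩ := aux_log α a h0 h1 haα
  have ha : 0 < a := by
    by_contra h
    nlinarith
  have hnp : (0 : ℝ) < n := by positivity
  have hB : 0 < 1 - α ^ n := by
    have := pow_lt_one₀ h0.le h1 (n := n) (by omega)
    linarith
  set l := Real.log (1 / α) with hldef
  set y := 1 / l with hy
  have hyp : 0 < y := by positivity
  have elog : Real.log α = -l := by rw [hldef, one_div, Real.log_inv]; ring
  set B := 1 - α ^ n with hBdef
  set P := α ^ (n + 1 - m) with hP
  have hPp : 0 < P := by positivity
  -- w = n P / (B y)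
  have hw := Real.log_le_sub_one_of_pos (show 0 < n * P / (B * y) by positivity)
  have hlogP : Real.log P = -(((n : ℝ) + 1 - m) * l) := by
    rw [hP, Real.log_pow, elog, Nat.cast_sub (by omega)]; push_cast; ring
  have e1 : Real.log (n * P / (B * y)) =
      Real.log n + Real.log P - (Real.log B + Real.log y) := by
    rw [Real.log_div (by positivity) (by positivity), Real.log_mul (by positivity) (by positivity),
      Real.log_mul (by positivity) (by positivity)]
  have e2 : Real.log ((a / n) * B / α ^ (n + 1)) =
      Real.log a - Real.log n + Real.log B + ((n : ℝ) + 1) * l := by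
    rw [Real.log_div (by positivity) (by positivity), Real.log_mul (by positivity) (by positivity),
      Real.log_div (by positivity) (by positivity), Real.log_pow, elog]; push_cast; ring
  have hya : Real.log y ≤ Real.log a := Real.log_le_log hyp hy2
  have hkey : Real.log (n * P / (B * y)) ≥ m * l - Real.log ((a / n) * B / α ^ (n + 1)) := by
    rw [e1, e2, hlogP]; nlinarith
  have hkey2 : m * l - Real.log ((a / n) * B / α ^ (n + 1)) ≤ n * P / (B * y) - 1 := by linarith
  have hyl : y * l = 1 := by rw [hy]; field_simp
  have hkey3 : (m : ℝ) - y * Real.log ((a / n) * B / α ^ (n + 1)) ≤ n * P / B - y := by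
    have := mul_le_mul_of_nonneg_left hkey2 hyp.le
    have e3 : y * (n * P / (B * y) - 1) = n * P / B - y := by field_simp
    have e4 : y * (m * l - Real.log ((a / n) * B / α ^ (n + 1))) =
        m - y * Real.log ((a / n) * B / α ^ (n + 1)) := by
      linear_combination (m : ℝ) * hyl
    linarith
  have hC : a * α ^ 2 * (1 - α ^ (n - 1)) / B ≤ y := by
    have hαp : α * α ^ (n - 1) = α ^ n := by
      rw [← pow_succ']; congr 1; omega
    have : a * α ^ 2 * (1 - α ^ (n - 1)) / B ≤ a * α := by
      rw [div_le_iff₀ hB]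
      have : a * α ^ 2 * (1 - α ^ (n - 1)) = a * α * (α - α ^ n) := by rw [← hαp]; ring
      rw [this, hBdef]
      gcongr
    linarith
  have hfin := div_le_div_of_nonneg_right
    (show (m : ℝ) - n * P / B ≤ y * Real.log ((a / n) * B / α ^ (n + 1))
      - a * α ^ 2 * (1 - α ^ (n - 1)) / B by linarith) hnp.le
  have f1 : ((m : ℝ) - n * P / B) / n = m / n - P / B := by field_simp
  have f2 : (y * Real.log ((a / n) * B / α ^ (n + 1)) - a * α ^ 2 * (1 - α ^ (n - 1)) / B) / n =
      1 / (n * l) * Real.log ((a / n) * B / α ^ (n + 1)) -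
        a * α ^ 2 * (1 - α ^ (n - 1)) / (n * B) := by
    rw [hy, sub_div, div_div, mul_comm B]; congr 1; field_simp
  rw [f1, f2] at hfin
  rw [sub_div]
  linarith

lemma aux_lower (α a : ℝ) (n : ℕ) (hn : 2 ≤ n) (h0 : 0 < α) (h1 : α < 1)
    (haα : a * (1 - α) = 1) :
    ∃ m ≤ n, α ^ n / (1 - α ^ (n - 1)) -
        a * (1 - α ^ n) / ((n : ℝ) * α * (1 - α ^ (n - 1))) +
        (1 / ((n : ℝ) * Real.log (1 / α))) *
          Real.log ((a / n) * (1 - α ^ (n - 1)) / α ^ (n - 1)) ≤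
      max 0 ((m : ℝ) / n - (α ^ (n - m) - α ^ n) / (1 - α ^ (n - 1))) := by
  obtain ⟨hl, hy1, hy2⟩ := aux_log α a h0 h1 haα
  have ha : 0 < a := by
    by_contra h
    nlinarith
  have hnp : (0 : ℝ) < n := by positivity
  have hB : 0 < 1 - α ^ (n - 1) := by
    have := pow_lt_one₀ h0.le h1 (n := n - 1) (by omega)
    linarith
  have hαp : α * α ^ (n - 1) = α ^ n := by
    rw [← pow_succ']; congr 1; omega
  set l := Real.log (1 / α) with hldef
  have elog : Real.log α = -l := by rw [hldef, one_div, Real.log_inv]; ring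
  set B := 1 - α ^ (n - 1) with hBdef
  set K := Real.log ((a / n) * B / α ^ (n - 1)) with hK
  set T := K / l + 1 with hT
  -- a (1 - α^N) is a geometric sum
  have hgeom : ∀ N : ℕ, a * (1 - α ^ N) = ∑ j ∈ Finset.range N, α ^ j := by
    intro N
    have := geom_sum_mul_neg α N
    rw [← this]
    linear_combination (∑ j ∈ Finset.range N, α ^ j) * haα
  have hKe : (1 / ((n : ℝ) * l)) * K = (T - 1) / n := by
    rw [hT]; field_simp; ring
  have hKT : K = (T - 1) * l := by rw [hT]; field_simp; ring
  have hexpK : Real.exp K = (a / n) * B / α ^ (n - 1) := Real.exp_log (by positivity)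
  have hexpα : ∀ k : ℕ, α ^ k = Real.exp (-(k * l)) := by
    intro k
    rw [← Real.exp_log (show 0 < α ^ k by positivity), Real.log_pow, elog]; congr 1; ring
  have hexpT : a * B / n = α ^ n * Real.exp (T * l) := by
    have : T * l = K + l := by rw [hKT]; ring
    rw [this, Real.exp_add, hexpK, hldef, Real.exp_log (by positivity), ← hαp]
    field_simp
  rw [hKe]
  by_cases hT0 : 0 ≤ T
  · have hTn : T ≤ n := by
      have h3 : a * B ≤ n := by
        rw [hBdef, hgeom]
        calc ∑ j ∈ Finset.range (n - 1), α ^ j ≤ ∑ j ∈ Finset.range (n - 1), (1 : ℝ) :=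
              Finset.sum_le_sum fun j _ => pow_le_one₀ h0.le h1.le
          _ = ((n - 1 : ℕ) : ℝ) := by simp
          _ ≤ n := by exact_mod_cast Nat.sub_le n 1
      have h4 : a * B / n ≤ 1 := by rw [div_le_one hnp]; exact h3
      rw [hexpT, hexpα, ← Real.exp_add, Real.exp_le_one_iff] at h4
      by_contra h
      push Not at h
      nlinarith
    have hfl : ⌊T⌋₊ ≤ n := by
      exact Nat.floor_le_of_le hTn
    refine ⟨⌊T⌋₊, hfl, le_max_of_le_right ?_⟩
    have hf1 : T - 1 ≤ (⌊T⌋₊ : ℝ) := by linarith [Nat.lt_floor_add_one T]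
    have hf2 : (⌊T⌋₊ : ℝ) ≤ T := Nat.floor_le hT0
    have hpow : α ^ (n - ⌊T⌋₊) ≤ a * B / n := by
      rw [hexpT, hexpα, hexpα, ← Real.exp_add, Real.exp_le_exp, Nat.cast_sub hfl]
      nlinarith
    have hA : a / n ≤ a * (1 - α ^ n) / (n * α * B) := by
      rw [div_le_div_iff₀ hnp (by positivity)]
      have : α * B ≤ 1 - α ^ n := by rw [hBdef]; nlinarith
      have := mul_le_mul_of_nonneg_left this (mul_pos ha hnp).le
      nlinarith
    have hpow2 : α ^ (n - ⌊T⌋₊) / B ≤ a / n := by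
      rw [div_le_iff₀ hB]; calc _ ≤ _ := hpow
        _ = _ := by ring
    have : (T - 1) / n ≤ (⌊T⌋₊ : ℝ) / n := by gcongr
    rw [sub_div (α ^ (n - ⌊T⌋₊))]
    linarith
  · push Not at hT0
    refine ⟨0, by omega, le_max_of_le_left ?_⟩
    have h5 : (T - 1) / n ≤ 0 := div_nonpos_of_nonpos_of_nonneg (by linarith) hnp.le
    have h6 : α ^ n / B ≤ a * (1 - α ^ n) / (n * α * B) := by
      rw [div_le_div_iff₀ hB (by positivity), hgeom]
      have : (n : ℝ) * α ^ (n + 1) ≤ ∑ j ∈ Finset.range n, α ^ j := by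
        calc (n : ℝ) * α ^ (n + 1) = ∑ j ∈ Finset.range n, α ^ (n + 1) := by simp
          _ ≤ _ := Finset.sum_le_sum fun j hj => by
            rw [Finset.mem_range] at hj
            exact pow_le_pow_of_le_one h0.le h1.le (by omega)
      calc α ^ n * (n * α * B) = (n * α ^ (n + 1)) * B := by ring
        _ ≤ _ := by gcongr
    linarith

/-- Bounds on the total variation distance from uniform of the position of the original
bottom card after an `a`-shuffle of `n` cards. -/
theorem statement5 (n a : ℕ) (hn : 2 ≤ n) (ha : 2 ≤ a)
    (α : ℝ) (hα : α = 1 - 1 / (a : ℝ))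
    (Q : ℕ → ℝ)
    (hQ : ∀ i, Q i = (1 / (a : ℝ) ^ n) *
      ∑ k ∈ Finset.Icc 1 a, ((k : ℝ) - 1) ^ (n - i) * (k : ℝ) ^ (i - 1))
    (TV : ℝ)
    (hTV : TV = (1 / 2) * ∑ i ∈ Finset.Icc 1 n, |Q i - 1 / (n : ℝ)|) :
    TV ≤ α ^ (n + 1) / (1 - α ^ n) -
        (a : ℝ) * α ^ 2 * (1 - α ^ (n - 1)) / ((n : ℝ) * (1 - α ^ n)) +
        (1 / ((n : ℝ) * Real.log (1 / α))) *
          Real.log (((a : ℝ) / n) * (1 - α ^ n) / α ^ (n + 1)) ∧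
    α ^ n / (1 - α ^ (n - 1)) -
        (a : ℝ) * (1 - α ^ n) / ((n : ℝ) * α * (1 - α ^ (n - 1))) +
        (1 / ((n : ℝ) * Real.log (1 / α))) *
          Real.log (((a : ℝ) / n) * (1 - α ^ (n - 1)) / α ^ (n - 1)) ≤ TV := by
  have haR : (2 : ℝ) ≤ a := by exact_mod_cast ha
  have ha0 : (0 : ℝ) < a := by linarith
  have hnR : (2 : ℝ) ≤ n := by exact_mod_cast hn
  have hnp : (0 : ℝ) < n := by linarith
  have haα : (a : ℝ) * (1 - α) = 1 := by rw [hα]; field_simp; ring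
  have haα' : (a : ℝ) * α = a - 1 := by linarith
  have h0 : 0 < α := by nlinarith
  have h1 : α < 1 := by nlinarith
  have h1a : 1 - α = 1 / a := by rw [hα]; ring
  have hB : 0 < 1 - α ^ n := by
    have := pow_lt_one₀ h0.le h1 (n := n) (by omega)
    linarith
  have hB' : 0 < 1 - α ^ (n - 1) := by
    have := pow_lt_one₀ h0.le h1 (n := n - 1) (by omega)
    linarith
  -- total mass one
  have hsum : ∑ i ∈ Finset.Icc 1 n, Q i = 1 := by
    simp_rw [hQ]
    rw [← Finset.mul_sum, Finset.sum_comm]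
    have : ∀ k ∈ Finset.Icc 1 a, ∑ i ∈ Finset.Icc 1 n, ((k : ℝ) - 1) ^ (n - i) * (k : ℝ) ^ (i - 1)
        = (k : ℝ) ^ n - ((k : ℝ) - 1) ^ n := by
      intro k _
      rw [← aux_inner]; ring
    rw [Finset.sum_congr rfl this, aux_tele n a (by omega)]
    field_simp
  have hQ1 : Q 1 = (1 / (a : ℝ) ^ n) * ∑ k ∈ Finset.Icc 1 a, ((k : ℝ) - 1) ^ (n - 1) := by
    rw [hQ]; simp
  have hQn : Q n = (1 / (a : ℝ) ^ n) * ∑ k ∈ Finset.Icc 1 a, (k : ℝ) ^ (n - 1) := by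
    rw [hQ]; simp
  have hdiff : Q n - Q 1 = 1 / a := by
    rw [hQ1, hQn, ← mul_sub, ← Finset.sum_sub_distrib, aux_tele (n - 1) a (by omega)]
    have : (a : ℝ) ^ n = a ^ (n - 1) * a := by rw [← pow_succ]; congr 1; omega
    rw [this]; field_simp
  -- bounds on the terms
  have hk : ∀ k ∈ Finset.Icc 1 a, 0 ≤ (k : ℝ) - 1 ∧ (k : ℝ) - 1 ≤ α * k := by
    intro k hk
    rw [Finset.mem_Icc] at hk
    have k1 : (1 : ℝ) ≤ k := by exact_mod_cast hk.1
    have k2 : (k : ℝ) ≤ a := by exact_mod_cast hk.2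
    refine ⟨by linarith, ?_⟩
    have : (1 - α) * k ≤ (1 - α) * a := by gcongr
    nlinarith
  have hup : ∀ i ∈ Finset.Icc 1 n, Q i ≤ α ^ (n - i) * Q n := by
    intro i hi
    rw [Finset.mem_Icc] at hi
    rw [hQ, hQn, mul_left_comm]
    refine mul_le_mul_of_nonneg_left ?_ (by positivity)
    rw [Finset.mul_sum]
    refine Finset.sum_le_sum fun k hkm => ?_
    obtain ⟨p1, p2⟩ := hk k hkm
    calc ((k : ℝ) - 1) ^ (n - i) * (k : ℝ) ^ (i - 1) ≤ (α * k) ^ (n - i) * (k : ℝ) ^ (i - 1) := by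
          gcongr
      _ = α ^ (n - i) * ((k : ℝ) ^ (n - i) * (k : ℝ) ^ (i - 1)) := by rw [mul_pow]; ring
      _ = _ := by rw [← pow_add]; congr 2; omega
  have hlo : ∀ i ∈ Finset.Icc 1 n, Q 1 ≤ α ^ (i - 1) * Q i := by
    intro i hi
    rw [Finset.mem_Icc] at hi
    rw [hQ i, hQ1, mul_left_comm]
    refine mul_le_mul_of_nonneg_left ?_ (by positivity)
    rw [Finset.mul_sum]
    refine Finset.sum_le_sum fun k hkm => ?_
    obtain ⟨p1, p2⟩ := hk k hkm
    calc ((k : ℝ) - 1) ^ (n - 1) = ((k : ℝ) - 1) ^ (n - i) * ((k : ℝ) - 1) ^ (i - 1) := by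
          rw [← pow_add]; congr 1; omega
      _ ≤ ((k : ℝ) - 1) ^ (n - i) * (α * k) ^ (i - 1) := by gcongr
      _ = _ := by rw [mul_pow]; ring
  have hQnU : Q n ≤ 1 / (a * (1 - α ^ (n - 1))) := by
    have := hup 1 (by simp; omega)
    rw [le_div_iff₀ (by positivity)]
    have h2 : Q n * (1 - α ^ (n - 1)) ≤ 1 / a := by nlinarith
    calc Q n * (a * (1 - α ^ (n - 1))) = a * (Q n * (1 - α ^ (n - 1))) := by ring
      _ ≤ a * (1 / a) := by gcongr
      _ = 1 := by field_simp
  have hQ1L : α ^ n * Q n ≤ Q 1 := by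
    obtain ⟨c, rfl⟩ : ∃ c, a = c + 1 := ⟨a - 1, by omega⟩
    obtain ⟨N, rfl⟩ : ∃ N, n = N + 1 := ⟨n - 1, by omega⟩
    have hs := aux_sum N c (by omega)
    have hc : (1 : ℝ) ≤ c := by exact_mod_cast (by omega : 1 ≤ c)
    have hNs : N ≠ 0 := by omega
    have e1 : ∑ k ∈ Finset.Icc 1 (c + 1), ((k : ℝ) - 1) ^ N = ∑ k ∈ Finset.Icc 1 c, (k : ℝ) ^ N := by
      have t := aux_tele N (c + 1) hNs
      rw [Finset.sum_sub_distrib, Finset.sum_Icc_succ_top (by omega)] at t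
      linarith
    rw [hQ1, hQn]
    simp only [Nat.add_sub_cancel]
    rw [e1, Finset.sum_Icc_succ_top (by omega)]
    set S := ∑ k ∈ Finset.Icc 1 c, (k : ℝ) ^ N
    have hαc : α = c / (c + 1) := by rw [hα]; push_cast; field_simp; ring
    rw [mul_left_comm]
    gcongr
    rw [hαc, div_pow, div_mul_eq_mul_div, div_le_iff₀ (by positivity)]
    push_cast
    linarith
  have hQ1L' : α ^ n / (a * (1 - α ^ n)) ≤ Q 1 := by
    rw [div_le_iff₀ (by positivity)]
    have h2 : α ^ n * (1 / a) ≤ Q 1 * (1 - α ^ n) := by rw [← hdiff]; linarith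
    have := mul_le_mul_of_nonneg_left h2 ha0.le
    have e : a * (α ^ n * (1 / a)) = α ^ n := by field_simp
    linarith
  have hL : ∀ i ∈ Finset.Icc 1 n, α ^ (n + 1 - i) * (1 / (a * (1 - α ^ n))) ≤ Q i := by
    intro i hi
    have h := hQ1L'.trans (hlo i hi)
    rw [Finset.mem_Icc] at hi
    have e : α ^ n = α ^ (i - 1) * α ^ (n + 1 - i) := by rw [← pow_add]; congr 1; omega
    refine le_of_mul_le_mul_left ?_ (show 0 < α ^ (i - 1) by positivity)
    calc _ = (α ^ (i - 1) * α ^ (n + 1 - i)) / (a * (1 - α ^ n)) := by ring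
      _ = α ^ n / (a * (1 - α ^ n)) := by rw [← e]
      _ ≤ _ := h
  have hU : ∀ i ∈ Finset.Icc 1 n, Q i ≤ α ^ (n - i) * (1 / (a * (1 - α ^ (n - 1)))) := by
    intro i hi
    exact (hup i hi).trans (by gcongr)
  -- TV as a sum of positive parts
  have hTV' : TV = ∑ i ∈ Finset.Icc 1 n, max (1 / (n : ℝ) - Q i) 0 := by
    have hz : ∑ i ∈ Finset.Icc 1 n, (1 / (n : ℝ) - Q i) = 0 := by
      rw [Finset.sum_sub_distrib, hsum]; simp; field_simp; ring
    have : ∀ i, max (1 / (n : ℝ) - Q i) 0 = (1 / 2) * |Q i - 1 / n| + (1 / 2) * (1 / n - Q i) := by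
      intro i
      rcases le_total (Q i) (1 / n) with h | h
      · rw [max_eq_left (by linarith), abs_of_nonpos (by linarith)]; ring
      · rw [max_eq_right (by linarith), abs_of_nonneg (by linarith)]; ring
    simp_rw [this]
    rw [Finset.sum_add_distrib, ← Finset.mul_sum, ← Finset.mul_sum, hz, hTV]; ring
  constructor
  · obtain ⟨m, hm, e⟩ := aux_pos_part
      (fun i => 1 / (n : ℝ) - α ^ (n + 1 - i) * (1 / (a * (1 - α ^ n)))) n (by
        intro i j _ hij hj
        have : α ^ (n + 1 - i) ≤ α ^ (n + 1 - j) := pow_le_pow_of_le_one h0.le h1.le (by omega)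
        gcongr)
    have hle : TV ≤ ∑ i ∈ Finset.Icc 1 m, (1 / (n : ℝ) - α ^ (n + 1 - i) * (1 / (a * (1 - α ^ n)))) := by
      rw [hTV', ← e]
      refine Finset.sum_le_sum fun i hi => max_le_max ?_ le_rfl
      linarith [hL i hi]
    refine hle.trans (le_trans (le_of_eq ?_) (aux_upper α a n m hn hm h0 h1 haα))
    rw [Finset.sum_sub_distrib, aux_geom α _ h1.ne (n + 1) m (by omega), h1a]
    simp
    field_simp
  · obtain ⟨m, hm, hb⟩ := aux_lower α a n hn h0 h1 haα
    refine hb.trans (max_le ?_ ?_)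
    · rw [hTV']; exact Finset.sum_nonneg fun i _ => le_max_right _ _
    · have hge : ∑ i ∈ Finset.Icc 1 m, (1 / (n : ℝ) - α ^ (n - i) * (1 / (a * (1 - α ^ (n - 1))))) ≤ TV := by
        rw [hTV']
        have hsub : Finset.Icc 1 m ⊆ Finset.Icc 1 n := Finset.Icc_subset_Icc le_rfl hm
        refine le_trans (Finset.sum_le_sum fun i hi => ?_)
          (Finset.sum_le_sum_of_subset_of_nonneg hsub fun i _ _ => le_max_right _ _)
        exact le_max_of_le_left (by linarith [hU i (hsub hi)])
      refine le_trans (le_of_eq ?_) hge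
      rw [Finset.sum_sub_distrib, aux_geom α _ h1.ne n m hm, h1a]
      simp
      field_simp
end

section
/- Let a be a positive real number, let r, s ≥ 2 be natural numbers, and let ξ ∈ [0,1]. Define S(a, ξ; r, s) = a^{-(r+s)} · Σ over integers k with 0 ≤ k ≤ a - ξ of (k+ξ)^r · (a-k-ξ)^s. Then there exists a real number θ ∈ [-1,1] such that S(a, ξ; r, s) = a·r!·s!/(r+s+1)! + (θ/(6a))·(r!·s!/(r+s-1)!)·(1/(r-1) + 1/(s-1)). -/
theorem aux_beta (a : ℝ) (n : ℕ) : ∀ m : ℕ, ∫ x in (0:ℝ)..a, x ^ m * (a - x) ^ n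
    = a ^ (m + n + 1) * ((m.factorial : ℝ) * (n.factorial : ℝ) / ((m + n + 1).factorial : ℝ)) := by
  induction n with
  | zero =>
    intro m
    simp [integral_pow, Nat.factorial_succ]
    have h1 : (m.factorial : ℝ) ≠ 0 := by positivity
    have h2 : (m : ℝ) + 1 ≠ 0 := by positivity
    field_simp
  | succ n ih =>
    intro m
    have key : ((m:ℝ) + 1) * (∫ x in (0:ℝ)..a, x ^ m * (a - x) ^ (n + 1))
        - ((n:ℝ) + 1) * (∫ x in (0:ℝ)..a, x ^ (m + 1) * (a - x) ^ n) = 0 := by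
      rw [← intervalIntegral.integral_const_mul, ← intervalIntegral.integral_const_mul,
        ← intervalIntegral.integral_sub]
      · have := intervalIntegral.integral_eq_sub_of_hasDerivAt (a := 0) (b := a)
          (f := fun x : ℝ => x ^ (m + 1) * (a - x) ^ (n + 1))
          (f' := fun x : ℝ => ((m:ℝ) + 1) * (x ^ m * (a - x) ^ (n + 1))
            - ((n:ℝ) + 1) * (x ^ (m + 1) * (a - x) ^ n)) ?_ ?_
        · rw [this]; simp
        · intro x _
          have h := ((hasDerivAt_id x).pow (m + 1)).mul
            (((hasDerivAt_id x).const_sub a).pow (n + 1))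
          refine h.congr_deriv ?_
          simp
          ring
        · apply Continuous.intervalIntegrable
          fun_prop
      · apply Continuous.intervalIntegrable
        fun_prop
      · apply Continuous.intervalIntegrable
        fun_prop
    rw [ih (m + 1)] at key
    have h2 : (m : ℝ) + 1 ≠ 0 := by positivity
    have e : m + 1 + n + 1 = m + (n + 1) + 1 := by ring
    rw [e] at key
    apply mul_left_cancel₀ h2
    rw [sub_eq_zero.mp key]
    rw [Nat.factorial_succ m, Nat.factorial_succ n]
    push_cast
    ring

/-- One step of Euler-Maclaurin. -/
theorem aux_step (F f f1 f2 H h : ℝ → ℝ) (c u v : ℝ) (huv : u ≤ v) (hu : c ≤ u) (hv : v ≤ c + 1)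
    (hF : ∀ x, HasDerivAt F (f x) x) (hf : ∀ x, HasDerivAt f (f1 x) x)
    (hf1 : ∀ x, HasDerivAt f1 (f2 x) x) (hH : ∀ x, HasDerivAt H (h x) x)
    (hb : ∀ x ∈ Set.Icc u v, |f2 x| ≤ h x) :
    |(f1 v * ((v - c) ^ 2 - (v - c) + 1 / 6) / 2 - f v * (2 * (v - c) - 1) / 2 + F v)
      - (f1 u * ((u - c) ^ 2 - (u - c) + 1 / 6) / 2 - f u * (2 * (u - c) - 1) / 2 + F u)|
      ≤ (H v - H u) / 12 := by
  let G : ℝ → ℝ := fun x => f1 x * ((x - c) ^ 2 - (x - c) + 1 / 6) / 2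
    - f x * (2 * (x - c) - 1) / 2 + F x
  have hG : ∀ x, HasDerivAt G (f2 x * ((x - c) ^ 2 - (x - c) + 1 / 6) / 2) x := by
    intro x
    have hx : HasDerivAt (fun x : ℝ => x - c) 1 x := (hasDerivAt_id x).sub_const c
    have h1 := ((hf1 x).mul (((hx.pow 2).sub hx).add_const (1 / 6))).div_const 2
    have h2 := ((hf x).mul ((hx.const_mul 2).sub_const 1)).div_const 2
    refine ((h1.sub h2).add (hF x)).congr_deriv ?_
    simp
    ring
  have hB : ∀ x ∈ Set.Icc u v, |f2 x * ((x - c) ^ 2 - (x - c) + 1 / 6) / 2| ≤ h x / 12 := by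
    intro x hx
    have h1 : |(x - c) ^ 2 - (x - c) + 1 / 6| ≤ 1 / 6 := by
      rw [abs_le]
      have := hx.1
      have := hx.2
      constructor
      · nlinarith [sq_nonneg (x - c - 1 / 2)]
      · nlinarith [mul_nonneg (by linarith : 0 ≤ x - c) (by linarith : 0 ≤ c + 1 - x)]
    have h2 := mul_le_mul (hb x hx) h1 (abs_nonneg _) ((abs_nonneg _).trans (hb x hx))
    rw [abs_div, abs_mul, abs_two]
    linarith
  have mono : ∀ K k : ℝ → ℝ, (∀ x, HasDerivAt K (k x) x) → (∀ x ∈ Set.Icc u v, 0 ≤ k x) →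
      K u ≤ K v := by
    intro K k hK hk
    have : MonotoneOn K (Set.Icc u v) := by
      apply monotoneOn_of_hasDerivWithinAt_nonneg (convex_Icc u v) (f' := k)
      · exact fun x _ => (hK x).continuousAt.continuousWithinAt
      · exact fun x _ => (hK x).hasDerivWithinAt
      · exact fun x hx => hk x (interior_subset hx)
    exact this (Set.left_mem_Icc.2 huv) (Set.right_mem_Icc.2 huv) huv
  have m1 := mono (fun x => H x / 12 - G x) _ (fun x => ((hH x).div_const 12).sub (hG x))
    (fun x hx => by have := (abs_le.1 (hB x hx)).2; linarith)
  have m2 := mono (fun x => H x / 12 + G x) _ (fun x => ((hH x).div_const 12).add (hG x))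
    (fun x hx => by have := (abs_le.1 (hB x hx)).1; linarith)
  change |G v - G u| ≤ _
  rw [abs_le]
  constructor <;> linarith

theorem aux_sum_s12 (F f f1 f2 H h : ℝ → ℝ) (a ξ : ℝ) (ha : 0 < a) (h0 : 0 ≤ ξ) (h1 : ξ ≤ 1)
    (hF : ∀ x, HasDerivAt F (f x) x) (hf : ∀ x, HasDerivAt f (f1 x) x)
    (hf1 : ∀ x, HasDerivAt f1 (f2 x) x) (hH : ∀ x, HasDerivAt H (h x) x)
    (hb : ∀ x ∈ Set.Icc 0 a, |f2 x| ≤ h x)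
    (f0 : f 0 = 0) (fa : f a = 0) (f10 : f1 0 = 0) (f1a : f1 a = 0) :
    |(∑ k ∈ Finset.Icc (0 : ℤ) ⌊a - ξ⌋, f ((k : ℝ) + ξ)) - (F a - F 0)| ≤ (H a - H 0) / 12 := by
  have st := fun c u v huv hu hv hb => aux_step F f f1 f2 H h c u v huv hu hv hF hf hf1 hH hb
  rcases lt_or_ge a ξ with hlt | hge
  · have hfl : ⌊a - ξ⌋ < 0 := by
      rw [Int.floor_lt]; push_cast; linarith
    rw [Finset.Icc_eq_empty (by omega)]
    have := st (ξ - 1) 0 a ha.le (by linarith) (by linarith) hb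
    rw [f0, fa, f10, f1a] at this
    simp only [Finset.sum_empty, zero_sub, abs_neg]
    convert this using 2
    ring
  · obtain ⟨K, hK⟩ : ∃ K : ℕ, ⌊a - ξ⌋ = K :=
      Int.eq_ofNat_of_zero_le (Int.floor_nonneg.2 (by linarith))
    have hK1 : (K : ℝ) ≤ a - ξ := by
      have := Int.floor_le (a - ξ); rw [hK] at this; exact_mod_cast this
    have hK2 : a - ξ < K + 1 := by
      have := Int.lt_floor_add_one (a - ξ); rw [hK] at this; exact_mod_cast this
    have hsum : (∑ k ∈ Finset.Icc (0 : ℤ) ⌊a - ξ⌋, f ((k : ℝ) + ξ))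
        = ∑ k ∈ Finset.range (K + 1), f ((k : ℝ) + ξ) := by
      rw [hK]
      symm
      apply Finset.sum_bij (fun (k : ℕ) _ => (k : ℤ))
      · intro k hk; simp at hk ⊢; omega
      · intro k _ l _ hkl; exact_mod_cast hkl
      · intro k hk
        simp only [Finset.mem_Icc] at hk
        refine ⟨k.toNat, ?_, ?_⟩
        · simp; omega
        · simp [hk.1]
      · intro k _; simp
    rw [hsum]
    have ind : ∀ k : ℕ, (k : ℝ) + ξ ≤ a →
        |F (k + ξ) - F 0 - (∑ j ∈ Finset.range (k + 1), f ((j : ℝ) + ξ)) + f (k + ξ) / 2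
          + f1 (k + ξ) / 12| ≤ (H (k + ξ) - H 0) / 12 := by
      intro k
      induction k with
      | zero =>
        intro _
        have := st (ξ - 1) 0 ξ h0 (by linarith) (by linarith)
          (fun x hx => hb x ⟨hx.1, hx.2.trans hge⟩)
        rw [f0, f10] at this
        simp only [Nat.cast_zero, zero_add, Finset.sum_range_one]
        convert this using 2
        ring
      | succ k ih =>
        intro hk
        push_cast at hk ⊢
        have i1 := ih (by linarith)
        have hk0 : (0 : ℝ) ≤ k := Nat.cast_nonneg k
        have i2 := st (k + ξ) (k + ξ) (k + 1 + ξ) (by linarith) le_rfl (by linarith)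
          (fun x hx => hb x ⟨by linarith [hx.1], hx.2.trans hk⟩)
        rw [Finset.sum_range_succ]
        push_cast
        have i3 := (abs_add_le _ _).trans (add_le_add i1 i2)
        refine le_trans (le_of_eq ?_) (i3.trans (le_of_eq ?_))
        · congr 1; ring
        · ring
    have i1 := ind K (by linarith)
    have hk0 : (0 : ℝ) ≤ K := Nat.cast_nonneg K
    have i2 := st (K + ξ) (K + ξ) a (by linarith) le_rfl (by linarith)
          (fun x hx => hb x ⟨by linarith [hx.1], hx.2⟩)
    rw [fa, f1a] at i2
    have i3 := (abs_add_le _ _).trans (add_le_add i1 i2)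
    rw [abs_sub_comm]
    refine le_trans (le_of_eq ?_) (i3.trans (le_of_eq ?_))
    · congr 1; ring
    · ring

theorem aux_main (a ξ : ℝ) (ha : 0 < a) (h0 : 0 ≤ ξ) (h1 : ξ ≤ 1) (m n : ℕ) :
    |(∑ k ∈ Finset.Icc (0 : ℤ) ⌊a - ξ⌋,
        ((k : ℝ) + ξ) ^ (m + 2) * (a - (k : ℝ) - ξ) ^ (n + 2))
      - a ^ (m + n + 5) * (((m + 2).factorial : ℝ) * ((n + 2).factorial : ℝ)
        / ((m + n + 5).factorial : ℝ))|
      ≤ (2 * (((m : ℝ) + 2) * (n + 2) / (m + n + 4)) * a ^ 2 * (a ^ (m + n + 1) *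
        ((m.factorial : ℝ) * (n.factorial : ℝ) / ((m + n + 1).factorial : ℝ)))) / 12 := by
  have hN : (m : ℝ) + n + 4 ≠ 0 := by positivity
  set C : ℝ := ((m : ℝ) + 2) * (n + 2) / (m + n + 4) * a ^ 2 with hC
  have hC0 : 0 ≤ C := by positivity
  let f : ℝ → ℝ := fun x => x ^ (m + 2) * (a - x) ^ (n + 2)
  let f1 : ℝ → ℝ := fun x => (m + 2) * (x ^ (m + 1) * (a - x) ^ (n + 2))
    - (n + 2) * (x ^ (m + 2) * (a - x) ^ (n + 1))
  let p : ℝ → ℝ := fun x => x ^ m * (a - x) ^ n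
  let X : ℝ → ℝ := fun x => ((m : ℝ) + n + 4) * (m + n + 3) * (x - (m + 2) * a / (m + n + 4)) ^ 2
  let f2 : ℝ → ℝ := fun x => p x * (X x - C)
  let F : ℝ → ℝ := fun x => ∫ t in (0:ℝ)..x, f t
  let P : ℝ → ℝ := fun x => ∫ t in (0:ℝ)..x, p t
  have fc : Continuous f := by fun_prop
  have pc : Continuous p := by fun_prop
  have hF : ∀ x, HasDerivAt F (f x) x := fun x => fc.integral_hasStrictDerivAt 0 x |>.hasDerivAt
  have hP : ∀ x, HasDerivAt P (p x) x := fun x => pc.integral_hasStrictDerivAt 0 x |>.hasDerivAt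
  have gen : ∀ (i j : ℕ) (x : ℝ), HasDerivAt (fun x : ℝ => x ^ (i + 1) * (a - x) ^ (j + 1))
      ((i + 1) * (x ^ i * (a - x) ^ (j + 1)) - (j + 1) * (x ^ (i + 1) * (a - x) ^ j)) x := by
    intro i j x
    have h := ((hasDerivAt_id x).pow (i + 1)).mul (((hasDerivAt_id x).const_sub a).pow (j + 1))
    refine h.congr_deriv ?_
    simp
    ring
  have hf : ∀ x, HasDerivAt f (f1 x) x := by
    intro x
    refine (gen (m + 1) (n + 1) x).congr_deriv ?_
    simp only [f1]; push_cast; ring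
  have hf1 : ∀ x, HasDerivAt f1 (f2 x) x := by
    intro x
    refine (((gen m (n + 1) x).const_mul ((m : ℝ) + 2)).sub
      ((gen (m + 1) n x).const_mul ((n : ℝ) + 2))).congr_deriv ?_
    simp only [f2, p, X, hC]; push_cast
    field_simp
    ring
  have hH : ∀ x, HasDerivAt (fun x => f1 x + 2 * C * P x) (f2 x + 2 * C * p x) x :=
    fun x => (hf1 x).add ((hP x).const_mul _)
  have hb : ∀ x ∈ Set.Icc 0 a, |f2 x| ≤ f2 x + 2 * C * p x := by
    intro x hx
    have hp : 0 ≤ p x := mul_nonneg (pow_nonneg hx.1 _) (pow_nonneg (by linarith [hx.2]) _)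
    have hX : 0 ≤ X x := by positivity
    have := mul_nonneg hp hX
    have := mul_nonneg hp hC0
    rw [abs_le]
    simp only [f2]
    constructor <;> nlinarith
  have main := aux_sum_s12 F f f1 f2 _ _ a ξ ha h0 h1 hF hf hf1 hH hb (by simp [f]) (by simp [f])
    (by simp [f1]) (by simp [f1])
  have eF : F a - F 0 = a ^ (m + n + 5) * (((m + 2).factorial : ℝ) * ((n + 2).factorial : ℝ)
        / ((m + n + 5).factorial : ℝ)) := by
    simp only [F, f, intervalIntegral.integral_same, sub_zero]
    rw [aux_beta]
    rw [show m + 2 + (n + 2) + 1 = m + n + 5 by ring]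
  have eP : P a = a ^ (m + n + 1) *
        ((m.factorial : ℝ) * (n.factorial : ℝ) / ((m + n + 1).factorial : ℝ)) := aux_beta a n m
  have eP0 : P 0 = 0 := by simp [P]
  rw [eF] at main
  simp only [eP, eP0] at main
  have e1 : f1 a = 0 := by simp [f1]
  have e2 : f1 0 = 0 := by simp [f1]
  rw [e1, e2] at main
  refine le_trans (le_of_eq ?_) (main.trans (le_of_eq ?_))
  · congr 2
    apply Finset.sum_congr rfl
    intro k _
    simp only [f, sub_sub]
  · rw [hC]; ring


/-- Poisson-summation estimate:
`S(a,ξ;r,s) = a^{-(r+s)} Σ_{0 ≤ k ≤ a-ξ} (k+ξ)^r (a-k-ξ)^s` equals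
`a·r!s!/(r+s+1)! + (θ/(6a))·(r!s!/(r+s-1)!)(1/(r-1)+1/(s-1))` for some `θ ∈ [-1,1]`. -/
theorem statement12 (a : ℝ) (ha : 0 < a) (r s : ℕ) (hr : 2 ≤ r) (hs : 2 ≤ s)
    (ξ : ℝ) (hξ : ξ ∈ Set.Icc (0 : ℝ) 1)
    (S : ℝ)
    (hS : S = (1 / a ^ (r + s)) *
      ∑ k ∈ Finset.Icc (0 : ℤ) ⌊a - ξ⌋, ((k : ℝ) + ξ) ^ r * (a - (k : ℝ) - ξ) ^ s) :
    ∃ θ : ℝ, θ ∈ Set.Icc (-1 : ℝ) 1 ∧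
      S = a * ((r.factorial : ℝ) * (s.factorial : ℝ) / ((r + s + 1).factorial : ℝ)) +
        (θ / (6 * a)) * ((r.factorial : ℝ) * (s.factorial : ℝ) / ((r + s - 1).factorial : ℝ)) *
          (1 / ((r : ℝ) - 1) + 1 / ((s : ℝ) - 1)) := by
  obtain ⟨m, rfl⟩ : ∃ m, r = m + 2 := ⟨r - 2, by omega⟩
  obtain ⟨n, rfl⟩ : ∃ n, s = n + 2 := ⟨s - 2, by omega⟩
  have main := aux_main a ξ ha hξ.1 hξ.2 m n
  set T := ∑ k ∈ Finset.Icc (0 : ℤ) ⌊a - ξ⌋,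
        ((k : ℝ) + ξ) ^ (m + 2) * (a - (k : ℝ) - ξ) ^ (n + 2) with hT
  rw [show m + 2 + (n + 2) + 1 = m + n + 5 by ring, show m + 2 + (n + 2) - 1 = m + n + 3 by omega]
  rw [show m + 2 + (n + 2) = m + n + 4 by ring] at hS
  have em : ((m + 2 : ℕ) : ℝ) - 1 = m + 1 := by push_cast; ring
  have en : ((n + 2 : ℕ) : ℝ) - 1 = n + 1 := by push_cast; ring
  rw [em, en]
  set M := ((m + 2).factorial : ℝ) * ((n + 2).factorial : ℝ) / ((m + n + 5).factorial : ℝ) with hM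
  set D : ℝ := 1 / (6 * a) * (((m + 2).factorial : ℝ) * ((n + 2).factorial : ℝ)
    / ((m + n + 3).factorial : ℝ)) * (1 / ((m : ℝ) + 1) + 1 / ((n : ℝ) + 1)) with hD
  have hD0 : 0 < D := by positivity
  have hap : 0 < a ^ (m + n + 4) := by positivity
  have hbound : (2 * (((m : ℝ) + 2) * (n + 2) / (m + n + 4)) * a ^ 2 * (a ^ (m + n + 1) *
        ((m.factorial : ℝ) * (n.factorial : ℝ) / ((m + n + 1).factorial : ℝ)))) / 12
        = a ^ (m + n + 4) * (D * ((m + n + 3) / (m + n + 4))) := by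
    rw [hD, Nat.factorial_succ (m + 1), Nat.factorial_succ m, Nat.factorial_succ (n + 1),
      Nat.factorial_succ n, Nat.factorial_succ (m + n + 2), Nat.factorial_succ (m + n + 1)]
    have h1 : (m.factorial : ℝ) ≠ 0 := by positivity
    have h2 : (n.factorial : ℝ) ≠ 0 := by positivity
    have h3 : ((m + n + 1).factorial : ℝ) ≠ 0 := by positivity
    have h4 : (m : ℝ) + n + 4 ≠ 0 := by positivity
    have h5 : (m : ℝ) + n + 3 ≠ 0 := by positivity
    have h6 : (m : ℝ) + n + 2 ≠ 0 := by positivity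
    have h7 : (m : ℝ) + 1 ≠ 0 := by positivity
    have h8 : (n : ℝ) + 1 ≠ 0 := by positivity
    push_cast
    rw [show (m : ℝ) + n + 2 + 1 = m + n + 3 by ring, show (m : ℝ) + n + 1 + 1 = m + n + 2 by ring]
    field_simp
    ring
  have hle : |S - a * M| ≤ D := by
    have e : T - a ^ (m + n + 5) * M = a ^ (m + n + 4) * (S - a * M) := by
      rw [hS]; field_simp; ring
    rw [hbound, e, abs_mul, abs_of_pos hap] at main
    have := le_of_mul_le_mul_left main hap
    refine this.trans ?_
    apply mul_le_of_le_one_right hD0.le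
    rw [div_le_one (by positivity)]
    linarith
  refine ⟨(S - a * M) / D, ?_, ?_⟩
  · have := abs_le.1 hle
    constructor
    · rw [le_div_iff₀ hD0]; linarith
    · rw [div_le_one hD0]; linarith
  · have e : (S - a * M) / D / (6 * a) * (((m + 2).factorial : ℝ) * ((n + 2).factorial : ℝ)
      / ((m + n + 3).factorial : ℝ)) * (1 / ((m : ℝ) + 1) + 1 / ((n : ℝ) + 1))
      = (S - a * M) / D * D := by
      conv_rhs => rw [hD]
      ring
    rw [e, div_mul_cancel₀ _ hD0.ne']
    ring
end

section
/- Let m ≥ 2 and a be natural numbers, let ξ_1,…,ξ_m ∈ [0,1] be real numbers, and let r_1,…,r_m be natural numbers all at least r, where r ≥ 2. Define S_m(a; ξ, r) = Σ over nonnegative integers a_1,…,a_m with a_1+…+a_m = a of (a_1+ξ_1)^{r_1}·(a_2+ξ_2)^{r_2}⋯(a_m+ξ_m)^{r_m}. Then |S_m(a; ξ, r) - (r_1!⋯r_m!/(r_1+…+r_m+m-1)!)·(a+ξ_1+…+ξ_m)^{r_1+…+r_m+m-1}| ≤ r_1!⋯r_m! · Σ_{j=1}^{m-1} C(m-1, j)·(1/(3(r-1)))^j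 · (a+ξ_1+…+ξ_m)^{r_1+…+r_m+m-1-2j}/(r_1+…+r_m+m-1-2j)!. -/
/-- normalised power -/
noncomputable def FF (p : ℕ) (x : ℝ) : ℝ := x ^ p / (p.factorial : ℝ)

lemma FF_nonneg (p : ℕ) {x : ℝ} (hx : 0 ≤ x) : 0 ≤ FF p x := by
  unfold FF; positivity

lemma FF_zero (p : ℕ) : FF (p+1) 0 = 0 := by simp [FF]

lemma FF_succ (p : ℕ) (x : ℝ) : FF (p+1) x = x / (p+1) * FF p x := by
  unfold FF
  rw [Nat.factorial_succ]
  have : (p.factorial : ℝ) ≠ 0 := by positivity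
  have : (p + 1 : ℝ) ≠ 0 := by positivity
  push_cast
  field_simp
  ring

lemma FF_deriv (p : ℕ) (x : ℝ) : HasDerivAt (FF (p+1)) (FF p x) x := by
  have h := (hasDerivAt_pow (p+1) x).div_const (((p+1).factorial : ℕ) : ℝ)
  have e : FF (p+1) = fun x => x ^ (p+1) / (((p+1).factorial : ℕ) : ℝ) := rfl
  rw [e]
  refine h.congr_deriv ?_
  unfold FF
  rw [Nat.factorial_succ]
  have : (p.factorial : ℝ) ≠ 0 := by positivity
  have : (p + 1 : ℝ) ≠ 0 := by positivity
  push_cast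
  field_simp

lemma FF_deriv_sub (p : ℕ) (L x : ℝ) :
    HasDerivAt (fun t => FF (p+1) (L - t)) (-FF p (L - x)) x := by
  have h := (FF_deriv p (L - x)).comp x ((hasDerivAt_id x).const_sub L)
  simpa [Function.comp_def] using h

/-- antiderivative of `FF p t * FF q (L - t)` -/
noncomputable def BB (L : ℝ) : ℕ → ℕ → ℝ → ℝ
  | p, 0, t => FF (p+1) t
  | p, q+1, t => FF (p+1) t * FF (q+1) (L - t) + BB L (p+1) q t

lemma BB_deriv (L : ℝ) (q : ℕ) : ∀ (p : ℕ) (x : ℝ),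
    HasDerivAt (BB L p q) (FF p x * FF q (L - x)) x := by
  induction q with
  | zero =>
    intro p x
    have e : BB L p 0 = FF (p+1) := by funext t; simp [BB]
    rw [e]
    have := FF_deriv p x
    simpa [FF] using this
  | succ q ih =>
    intro p x
    have e : BB L p (q+1) = fun t => FF (p+1) t * FF (q+1) (L - t) + BB L (p+1) q t := by
      funext t; simp [BB]
    rw [e]
    refine HasDerivAt.congr_deriv (((FF_deriv p x).mul (FF_deriv_sub q L x)).add (ih (p+1) x)) ?_
    ring

lemma BB_zero (L : ℝ) (q : ℕ) : ∀ (p : ℕ), BB L p q 0 = 0 := by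
  induction q with
  | zero => intro p; simp [BB, FF_zero]
  | succ q ih => intro p; simp [BB, FF_zero, ih]

lemma BB_end (L : ℝ) (q : ℕ) : ∀ (p : ℕ), BB L p q L = FF (p+q+1) L := by
  induction q with
  | zero => intro p; simp [BB]
  | succ q ih =>
    intro p
    simp only [BB, sub_self, FF_zero, ih, mul_zero, zero_add]
    congr 1; ring

/-- one piece -/
lemma piece (g g1 P N G PP NN : ℝ → ℝ)
    (hg : ∀ x, HasDerivAt g (g1 x) x) (hg1 : ∀ x, HasDerivAt g1 (P x - N x) x)
    (hG : ∀ x, HasDerivAt G (g x) x) (hPP : ∀ x, HasDerivAt PP (P x) x)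
    (hNN : ∀ x, HasDerivAt NN (N x) x)
    (s α β : ℝ) (hsα : s ≤ α) (hαβ : α ≤ β) (hβ : β ≤ s + 1)
    (hP : ∀ x, α ≤ x → x ≤ β → 0 ≤ P x) (hN : ∀ x, α ≤ x → x ≤ β → 0 ≤ N x) :
    let Ψ := fun t : ℝ => (t - s) * (s + 1 - t) / 2 * g1 t - (s + 1/2 - t) * g t - G t
    Ψ β - Ψ α ≤ (PP β - PP α) / 8 ∧ -((NN β - NN α) / 8) ≤ Ψ β - Ψ α := by
  intro Ψ
  have hΨ : ∀ x, HasDerivAt Ψ ((x - s) * (s + 1 - x) / 2 * (P x - N x)) x := by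
    intro x
    have hK : HasDerivAt (fun t : ℝ => (t - s) * (s + 1 - t) / 2) (s + 1/2 - x) x := by
      refine HasDerivAt.congr_deriv (((((hasDerivAt_id x).sub_const s).mul
        ((hasDerivAt_id x).const_sub (s+1))).div_const 2)) ?_
      simp; ring
    have hK' : HasDerivAt (fun t : ℝ => s + 1/2 - t) (-1) x := (hasDerivAt_id x).const_sub _
    refine HasDerivAt.congr_deriv (((hK.mul (hg1 x)).sub (hK'.mul (hg x))).sub (hG x)) ?_
    ring
  have hk : ∀ x, α ≤ x → x ≤ β → 0 ≤ (x - s) * (s + 1 - x) / 2 ∧ (x - s) * (s + 1 - x) / 2 ≤ 1/8 := by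
    intro x h1 h2
    constructor
    · have : 0 ≤ (x - s) * (s + 1 - x) := mul_nonneg (by linarith) (by linarith)
      linarith
    · nlinarith [sq_nonneg (x - s - 1/2)]
  constructor
  · have hm : MonotoneOn (fun t => PP t / 8 - Ψ t) (Set.Icc α β) := by
      have hd : ∀ x, HasDerivAt (fun t => PP t / 8 - Ψ t) _ x :=
        fun x => ((hPP x).div_const 8).sub (hΨ x)
      apply monotoneOn_of_deriv_nonneg (convex_Icc α β)
      · exact fun x _ => (hd x).continuousAt.continuousWithinAt
      · exact fun x _ => (hd x).differentiableAt.differentiableWithinAt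
      · intro x hx
        rw [interior_Icc] at hx
        rw [(hd x).deriv]
        have h1 := hk x hx.1.le hx.2.le
        have h2 := hP x hx.1.le hx.2.le
        have h3 := hN x hx.1.le hx.2.le
        nlinarith [mul_nonneg h1.1 h3, mul_nonneg (sub_nonneg.2 h1.2) h2]
    have := hm (Set.left_mem_Icc.2 hαβ) (Set.right_mem_Icc.2 hαβ) hαβ
    simp only at this
    linarith
  · have hm : MonotoneOn (fun t => NN t / 8 + Ψ t) (Set.Icc α β) := by
      have hd : ∀ x, HasDerivAt (fun t => NN t / 8 + Ψ t) _ x :=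
        fun x => ((hNN x).div_const 8).add (hΨ x)
      apply monotoneOn_of_deriv_nonneg (convex_Icc α β)
      · exact fun x _ => (hd x).continuousAt.continuousWithinAt
      · exact fun x _ => (hd x).differentiableAt.differentiableWithinAt
      · intro x hx
        rw [interior_Icc] at hx
        rw [(hd x).deriv]
        have h1 := hk x hx.1.le hx.2.le
        have h2 := hP x hx.1.le hx.2.le
        have h3 := hN x hx.1.le hx.2.le
        nlinarith [mul_nonneg h1.1 h2, mul_nonneg (sub_nonneg.2 h1.2) h3]
    have := hm (Set.left_mem_Icc.2 hαβ) (Set.right_mem_Icc.2 hαβ) hαβ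
    simp only at this
    linarith

lemma trap (g g1 P N G PP NN : ℝ → ℝ)
    (hg : ∀ x, HasDerivAt g (g1 x) x) (hg1 : ∀ x, HasDerivAt g1 (P x - N x) x)
    (hG : ∀ x, HasDerivAt G (g x) x) (hPP : ∀ x, HasDerivAt PP (P x) x)
    (hNN : ∀ x, HasDerivAt NN (N x) x)
    (a : ℕ) (ξ η L : ℝ) (hξ : 0 ≤ ξ) (hξ1 : ξ ≤ 1) (hη : 0 ≤ η) (hη1 : η ≤ 1)
    (hL : L = a + ξ + η)
    (hP : ∀ x, 0 ≤ x → x ≤ L → 0 ≤ P x) (hN : ∀ x, 0 ≤ x → x ≤ L → 0 ≤ N x)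
    (h0 : g 0 = 0) (h0' : g1 0 = 0) (h1 : g L = 0) (h1' : g1 L = 0) :
    (∑ k ∈ Finset.range (a+1), g (k + ξ)) - (G L - G 0) ≤ (PP L - PP 0) / 8 ∧
    -((NN L - NN 0) / 8) ≤ (∑ k ∈ Finset.range (a+1), g (k + ξ)) - (G L - G 0) := by
  have key : ∀ n : ℕ, n ≤ a →
    (∑ k ∈ Finset.range (n+1), g (k + ξ)) - g (n + ξ) / 2 - (G (n + ξ) - G 0)
      ≤ (PP (n + ξ) - PP 0) / 8 ∧
    -((NN (n + ξ) - NN 0) / 8) ≤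
      (∑ k ∈ Finset.range (n+1), g (k + ξ)) - g (n + ξ) / 2 - (G (n + ξ) - G 0) := by
    intro n
    induction n with
    | zero =>
      intro _
      have ha : (0:ℝ) ≤ a := Nat.cast_nonneg a
      have := piece g g1 P N G PP NN hg hg1 hG hPP hNN (ξ - 1) 0 ξ (by linarith) hξ (by linarith)
        (fun x h1 h2 => hP x h1 (by linarith)) (fun x h1 h2 => hN x h1 (by linarith))
      simp only [h0, h0'] at this
      simp only [zero_add, Finset.sum_range_one, Nat.cast_zero]
      constructor
      · refine le_trans (le_of_eq ?_) this.1; ring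
      · refine le_trans this.2 (le_of_eq ?_); ring
    | succ n ih =>
      intro hn
      have ih := ih (by omega)
      have ha : (n:ℝ) + 1 ≤ a := by exact_mod_cast hn
      have hn0 : (0:ℝ) ≤ n := Nat.cast_nonneg n
      have := piece g g1 P N G PP NN hg hg1 hG hPP hNN (n + ξ) (n + ξ) (n + 1 + ξ) le_rfl
        (by linarith) (by linarith)
        (fun x h1 h2 => hP x (by linarith) (by linarith))
        (fun x h1 h2 => hN x (by linarith) (by linarith))
      rw [Finset.sum_range_succ]
      generalize (∑ k ∈ Finset.range (n+1), g (k + ξ)) = Z at ih ⊢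
      push_cast
      constructor
      · have t := add_le_add ih.1 this.1
        ring_nf at t ⊢
        linarith
      · have t := add_le_add ih.2 this.2
        ring_nf at t ⊢
        linarith
  have k := key a le_rfl
  have ha : (0:ℝ) ≤ a := Nat.cast_nonneg a
  have := piece g g1 P N G PP NN hg hg1 hG hPP hNN (a + ξ) (a + ξ) L le_rfl
        (by linarith) (by linarith)
        (fun x h1 h2 => hP x (by linarith) (by linarith))
        (fun x h1 h2 => hN x (by linarith) (by linarith))
  simp only [h1, h1'] at this
  generalize (∑ k ∈ Finset.range (a+1), g (k + ξ)) = Z at k ⊢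
  constructor
  · have t := add_le_add k.1 this.1
    ring_nf at t ⊢
    linarith
  · have t := add_le_add k.2 this.2
    ring_nf at t ⊢
    linarith

lemma two (p q r a : ℕ) (hr : 2 ≤ r) (hp : r ≤ p) (hq : r ≤ q) (ξ η L : ℝ)
    (hξ : 0 ≤ ξ) (hξ1 : ξ ≤ 1) (hη : 0 ≤ η) (hη1 : η ≤ 1) (hL : L = a + ξ + η) :
    |(∑ k ∈ Finset.range (a+1), FF p (k + ξ) * FF q (L - (k + ξ))) - FF (p+q+1) L|
      ≤ 1 / (3 * ((r:ℝ) - 1)) * FF (p+q-1) L := by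
  obtain ⟨p, rfl⟩ : ∃ p', p = p' + 2 := ⟨p - 2, by omega⟩
  obtain ⟨q, rfl⟩ : ∃ q', q = q' + 2 := ⟨q - 2, by omega⟩
  have hL0 : 0 ≤ L := by rw [hL]; positivity
  have ep : (p + 1 : ℝ) ≠ 0 := by positivity
  have eq : (q + 1 : ℝ) ≠ 0 := by positivity
  have ep2 : (p + 1 + 1 : ℝ) ≠ 0 := by positivity
  have eq2 : (q + 1 + 1 : ℝ) ≠ 0 := by positivity
  have T := trap (fun t => FF (p+2) t * FF (q+2) (L - t))
    (fun t => FF (p+1) t * FF (q+2) (L - t) - FF (p+2) t * FF (q+1) (L - t))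
    (fun t => (1 + 1/((q:ℝ)+1)) * (FF p t * FF (q+2) (L - t)) - 2 * (FF (p+1) t * FF (q+1) (L - t))
      + (1 + 1/((p:ℝ)+1)) * (FF (p+2) t * FF q (L - t)))
    (fun t => (1/((q:ℝ)+1)) * (FF p t * FF (q+2) (L - t))
      + (1/((p:ℝ)+1)) * (FF (p+2) t * FF q (L - t)))
    (BB L (p+2) (q+2))
    (fun t => (1 + 1/((q:ℝ)+1)) * BB L p (q+2) t - 2 * BB L (p+1) (q+1) t
      + (1 + 1/((p:ℝ)+1)) * BB L (p+2) q t)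
    (fun t => (1/((q:ℝ)+1)) * BB L p (q+2) t + (1/((p:ℝ)+1)) * BB L (p+2) q t)
    (by
      intro x
      refine HasDerivAt.congr_deriv ((FF_deriv (p+1) x).mul (FF_deriv_sub (q+1) L x)) ?_
      ring)
    (by
      intro x
      refine HasDerivAt.congr_deriv (((FF_deriv p x).mul (FF_deriv_sub (q+1) L x)).sub
        ((FF_deriv (p+1) x).mul (FF_deriv_sub q L x))) ?_
      ring)
    (BB_deriv L (q+2) (p+2))
    (by
      intro x
      exact (((BB_deriv L (q+2) p x).const_mul _).sub ((BB_deriv L (q+1) (p+1) x).const_mul _)).add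
        ((BB_deriv L q (p+2) x).const_mul _))
    (by
      intro x
      exact (((BB_deriv L (q+2) p x).const_mul _)).add ((BB_deriv L q (p+2) x).const_mul _))
    a ξ η L hξ hξ1 hη hη1 hL
    (by
      intro x hx hx'
      have e : (1 + 1/((q:ℝ)+1)) * (FF p x * FF (q+2) (L - x)) - 2 * (FF (p+1) x * FF (q+1) (L - x))
          + (1 + 1/((p:ℝ)+1)) * (FF (p+2) x * FF q (L - x))
          = FF p x * FF q (L - x) * ((L - x)/(q+1) - x/(p+1))^2 := by
        rw [FF_succ (p+1), FF_succ p, FF_succ (q+1), FF_succ q]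
        push_cast
        field_simp
        ring
      rw [e]
      exact mul_nonneg (mul_nonneg (FF_nonneg _ hx) (FF_nonneg _ (by linarith))) (sq_nonneg _))
    (by
      intro x hx hx'
      have h1 := FF_nonneg p hx
      have h2 := FF_nonneg (p+2) hx
      have h3 := FF_nonneg q (sub_nonneg.2 hx')
      have h4 := FF_nonneg (q+2) (sub_nonneg.2 hx')
      positivity)
    (by simp [FF_zero]) (by simp [FF_zero]) (by simp [FF_zero]) (by simp [FF_zero])
  simp only [BB_end, BB_zero] at T
  have i1 : p + (q + 2) + 1 = p + 2 + (q + 2) - 1 := by omega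
  have i2 : p + 1 + (q + 1) + 1 = p + 2 + (q + 2) - 1 := by omega
  have i3 : p + 2 + q + 1 = p + 2 + (q + 2) - 1 := by omega
  rw [i1, i2, i3] at T
  have hA := FF_nonneg (p + 2 + (q + 2) - 1) hL0
  generalize FF (p + 2 + (q + 2) - 1) L = A at *
  have r1 : (0:ℝ) < (r:ℝ) - 1 := by
    have : (2:ℝ) ≤ r := by exact_mod_cast hr
    linarith
  have hp1 : 1 / ((p:ℝ)+1) ≤ 1 / ((r:ℝ) - 1) := by
    apply one_div_le_one_div_of_le r1
    have : (r:ℝ) ≤ p + 2 := by exact_mod_cast hp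
    linarith
  have hq1 : 1 / ((q:ℝ)+1) ≤ 1 / ((r:ℝ) - 1) := by
    apply one_div_le_one_div_of_le r1
    have : (r:ℝ) ≤ q + 2 := by exact_mod_cast hq
    linarith
  have hc : 1 / (3 * ((r:ℝ) - 1)) = 1 / ((r:ℝ) - 1) / 3 := by field_simp
  rw [hc]
  have z := mul_le_mul_of_nonneg_right hp1 hA
  have z' := mul_le_mul_of_nonneg_right hq1 hA
  have z2 : 0 ≤ 1 / ((r:ℝ) - 1) * A := by positivity
  rw [abs_le]
  constructor
  · linarith [T.2]
  · linarith [T.1]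

lemma sum_tuple_succ (n a : ℕ) (f : (Fin (n+1) → ℕ) → ℝ) :
    ∑ v ∈ Finset.Nat.antidiagonalTuple (n+1) a, f v =
    ∑ k ∈ Finset.range (a+1), ∑ w ∈ Finset.Nat.antidiagonalTuple n (a-k), f (Fin.cons k w) := by
  rw [Finset.sum_sigma']
  refine Finset.sum_bij' (fun v _ => (⟨v 0, Fin.tail v⟩ : (_ : ℕ) × (Fin n → ℕ)))
    (fun x _ => Fin.cons x.1 x.2) ?_ ?_ ?_ ?_ ?_
  · intro v hv
    rw [Finset.Nat.mem_antidiagonalTuple, Fin.sum_univ_succ] at hv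
    simp only [Finset.mem_sigma, Finset.mem_range, Finset.Nat.mem_antidiagonalTuple, Fin.tail]
    omega
  · rintro ⟨k, w⟩ hx
    simp only [Finset.mem_sigma, Finset.mem_range, Finset.Nat.mem_antidiagonalTuple] at hx
    rw [Finset.Nat.mem_antidiagonalTuple, Fin.sum_univ_succ]
    simp only [Fin.cons_zero, Fin.cons_succ]
    omega
  · intro v _; simp
  · rintro ⟨k, w⟩ _; simp
  · intro v _; simp

/-- normalised sum -/
noncomputable def TT (m a : ℕ) (ξ : Fin m → ℝ) (R : Fin m → ℕ) : ℝ :=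
  ∑ v ∈ Finset.Nat.antidiagonalTuple m a, ∏ i, FF (R i) ((v i : ℝ) + ξ i)

lemma TT_succ (n a : ℕ) (ξ : Fin (n+1) → ℝ) (R : Fin (n+1) → ℕ) :
    TT (n+1) a ξ R = ∑ k ∈ Finset.range (a+1),
      FF (R 0) (k + ξ 0) * TT n (a-k) (fun i => ξ i.succ) (fun i => R i.succ) := by
  unfold TT
  rw [sum_tuple_succ]
  refine Finset.sum_congr rfl fun k _ => ?_
  rw [Finset.mul_sum]
  refine Finset.sum_congr rfl fun w _ => ?_
  rw [Fin.prod_univ_succ]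
  simp

/-- error term -/
noncomputable def DD (n Q : ℕ) (c x : ℝ) : ℝ :=
  ∑ j ∈ Finset.range n, (n.choose (j+1) : ℝ) * c ^ (j+1) * FF (Q - 2 * (j+1)) x

lemma small (n r Q : ℕ) (hr : 2 ≤ r) (hQ : (r+1)*(n+1) ≤ Q + 1) (x : ℝ) (hx : 0 ≤ x)
    (hxn : x ≤ n) : FF Q x ≤ DD n Q (1 / (3 * ((r:ℝ) - 1))) x := by
  have r1 : (0:ℝ) < (r:ℝ) - 1 := by
    have : (2:ℝ) ≤ r := by exact_mod_cast hr
    linarith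
  obtain ⟨Q, rfl⟩ : ∃ q, Q = q + 2 := ⟨Q - 2, by
    have : r + 1 ≤ (r+1)*(n+1) := Nat.le_mul_of_pos_right _ (by omega)
    omega⟩
  rcases Nat.eq_zero_or_pos n with rfl | hn
  · have : x = 0 := le_antisymm (by simpa using hxn) hx
    subst this
    simp [DD, FF_zero]
  · have h1 : (n.choose (0+1) : ℝ) * (1 / (3 * ((r:ℝ) - 1))) ^ (0+1) * FF (Q + 2 - 2 * (0+1)) x
        ≤ DD n (Q+2) (1 / (3 * ((r:ℝ) - 1))) x := by
      unfold DD
      refine Finset.single_le_sum (f := fun j => (n.choose (j+1) : ℝ) *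
        (1 / (3 * ((r:ℝ) - 1))) ^ (j+1) * FF (Q + 2 - 2 * (j+1)) x) ?_ (Finset.mem_range.2 hn)
      intro j _
      have := FF_nonneg (Q + 2 - 2 * (j+1)) hx
      positivity
    refine le_trans ?_ h1
    rw [FF_succ (Q+1), FF_succ Q]
    simp only [zero_add, Nat.choose_one_right, pow_one, mul_one, Nat.add_sub_cancel]
    rw [← mul_assoc]
    refine mul_le_mul_of_nonneg_right ?_ (FF_nonneg _ hx)
    push_cast
    have hn' : (1:ℝ) ≤ n := by exact_mod_cast hn
    have hr' : (2:ℝ) ≤ r := by exact_mod_cast hr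
    have hQ' : ((r:ℝ)+1)*(n+1) ≤ Q + 3 := by exact_mod_cast hQ
    rw [div_mul_div_comm, mul_one_div, div_le_div_iff₀ (by positivity) (by positivity)]
    have e1 : 3 * (n:ℝ) ≤ Q + 1 + 1 := by nlinarith
    have e2 : (r:ℝ) - 1 ≤ Q + 1 := by nlinarith
    have e3 : x * x ≤ n * n := mul_le_mul hxn hxn hx (by positivity)
    calc x * x * (3 * ((r:ℝ) - 1)) ≤ n * n * (3 * ((r:ℝ) - 1)) := by gcongr
      _ = n * ((3 * n) * ((r:ℝ) - 1)) := by ring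
      _ ≤ n * ((Q + 1 + 1) * (Q + 1)) := by gcongr

lemma DD_step (n P : ℕ) (c x : ℝ) :
    (∑ j ∈ Finset.range n, (n.choose (j+1) : ℝ) * c ^ (j+1) *
      (FF (P - 2 * (j+1)) x + c * FF (P - 2 * (j+2)) x)) + c * FF (P - 2) x
      = DD (n+1) P c x := by
  have e : DD (n+1) P c x = (∑ j ∈ Finset.range (n+1),
        (n.choose (j+1) : ℝ) * c ^ (j+1) * FF (P - 2 * (j+1)) x) +
      ∑ j ∈ Finset.range (n+1), (n.choose j : ℝ) * c ^ (j+1) * FF (P - 2 * (j+1)) x := by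
    unfold DD
    rw [← Finset.sum_add_distrib]
    refine Finset.sum_congr rfl fun j _ => ?_
    rw [Nat.choose_succ_succ]
    push_cast
    ring
  rw [e, Finset.sum_range_succ, Finset.sum_range_succ' (fun j =>
    (n.choose j : ℝ) * c ^ (j+1) * FF (P - 2 * (j+1)) x)]
  simp only [Nat.choose_succ_self, mul_add, Finset.sum_add_distrib, Nat.choose_zero_right]
  have : ∀ j, (n.choose (j+1) : ℝ) * c ^ (j+1) * (c * FF (P - 2 * (j+2)) x)
    = (n.choose (j+1) : ℝ) * c ^ (j+1+1) * FF (P - 2 * (j+1+1)) x := by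
    intro j
    rw [pow_succ c (j+1)]; ring
  simp only [mul_add] at this
  simp only [this]
  simp
  ring

lemma main_ind (r : ℕ) (hr : 2 ≤ r) (n : ℕ) : ∀ (ξ : Fin (n+1) → ℝ)
    (_ : ∀ i, ξ i ∈ Set.Icc (0 : ℝ) 1) (R : Fin (n+1) → ℕ) (_ : ∀ i, r ≤ R i) (a : ℕ),
    |TT (n+1) a ξ R - FF ((∑ i, R i) + n) (a + ∑ i, ξ i)| ≤
      DD n ((∑ i, R i) + n) (1 / (3 * ((r:ℝ) - 1))) (a + ∑ i, ξ i) := by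
  induction n with
  | zero =>
    intro ξ hξ R hR a
    simp [TT, DD]
  | succ n ih =>
    intro ξ hξ R hR a
    have ih := ih (fun i => ξ i.succ) (fun i => hξ _) (fun i => R i.succ) (fun i => hR _)
    have r1 : (0:ℝ) < (r:ℝ) - 1 := by
      have : (2:ℝ) ≤ r := by exact_mod_cast hr
      linarith
    have hQ : (r+1)*(n+1) ≤ (∑ i : Fin (n+1), R i.succ) + n + 1 := by
      have : ∑ i : Fin (n+1), r ≤ ∑ i : Fin (n+1), R i.succ := Finset.sum_le_sum fun i _ => hR _
      simp at this
      nlinarith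
    have hη0 : 0 ≤ ∑ i : Fin (n+1), ξ i.succ := Finset.sum_nonneg fun i _ => (hξ _).1
    have hηn : ∑ i : Fin (n+1), ξ i.succ ≤ n + 1 := by
      have : ∑ i : Fin (n+1), ξ i.succ ≤ ∑ i : Fin (n+1), 1 :=
        Finset.sum_le_sum fun i _ => (hξ _).2
      simpa using this
    rw [TT_succ]
    generalize hT : (fun b => TT (n+1) b (fun i => ξ i.succ) (fun i => R i.succ)) = T at *
    have hT2 : ∀ b, TT (n+1) b (fun i => ξ i.succ) (fun i => R i.succ) = T b := fun b => by
      rw [← hT]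
    simp only [hT2] at ih ⊢
    rw [Fin.sum_univ_succ R, Fin.sum_univ_succ ξ]
    generalize (∑ i : Fin (n+1), ξ i.succ) = η at *
    have hPQ : R 0 + (∑ i : Fin (n+1), R i.succ) + (n+1) =
      R 0 + ((∑ i : Fin (n+1), R i.succ) + n) + 1 := by ring
    rw [hPQ]
    generalize (∑ i : Fin (n+1), R i.succ) + n = Q at *
    have hp := hR 0
    generalize R 0 = p at *
    have hx0 := hξ 0
    generalize ξ 0 = x0 at *
    clear hT hT2 hξ hR
    obtain ⟨hx0, hx1⟩ := hx0
    have hM := Nat.floor_le hη0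
    have hM1 := Nat.lt_floor_add_one η
    generalize ⌊η⌋₊ = M at *
    obtain ⟨η', rfl⟩ : ∃ η', η = M + η' := ⟨η - M, by ring⟩
    have hη'0 : 0 ≤ η' := by linarith
    have hη'1 : η' ≤ 1 := by linarith
    set c := 1 / (3 * ((r:ℝ) - 1)) with hc
    have hc0 : 0 ≤ c := by positivity
    -- extended sequence
    let T' : ℕ → ℝ := fun b => if M ≤ b then T (b - M) else 0
    have hT' : ∀ b : ℕ, |T' b - FF Q (b + η')| ≤ DD n Q c (b + η') := by
      intro b
      by_cases hb : M ≤ b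
      · have := ih (b - M)
        simp only [T', if_pos hb]
        rw [Nat.cast_sub hb] at this
        have e : (b:ℝ) - M + (M + η') = b + η' := by ring
        rwa [e] at this
      · simp only [T', if_neg hb, zero_sub, abs_neg]
        have hbn : (0:ℝ) ≤ (b:ℝ) + η' := by positivity
        rw [abs_of_nonneg (FF_nonneg _ hbn)]
        apply small n r Q hr hQ _ hbn
        have : (b:ℝ) + 1 ≤ M := by exact_mod_cast (by omega : b + 1 ≤ M)
        linarith
    have hsum : ∑ k ∈ Finset.range (a+1), FF p (k + x0) * T (a - k)
        = ∑ k ∈ Finset.range (a+M+1), FF p (k + x0) * T' (a + M - k) := by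
      have hsub : Finset.range (a+1) ⊆ Finset.range (a+M+1) :=
        Finset.range_subset_range.2 (by omega)
      rw [← Finset.sum_subset hsub]
      · refine Finset.sum_congr rfl fun k hk => ?_
        have hk := Finset.mem_range.1 hk
        simp only [T']
        rw [if_pos (by omega)]
        congr 2
        omega
      · intro k hk' hk
        have hk' := Finset.mem_range.1 hk'
        have hk : ¬ k < a + 1 := fun h => hk (Finset.mem_range.2 h)
        simp only [T']
        rw [if_neg (by omega), mul_zero]
    rw [hsum]
    set L : ℝ := (a:ℝ) + (x0 + (M + η')) with hL
    have hL0 : 0 ≤ L := by positivity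
    have hL' : L = ((a+M : ℕ) : ℝ) + x0 + η' := by rw [hL]; push_cast; ring
    have hpos : ∀ k ∈ Finset.range (a+M+1), ((a + M - k : ℕ) : ℝ) + η' = L - (k + x0) := by
      intro k hk
      have hk := Finset.mem_range.1 hk
      rw [Nat.cast_sub (by omega), hL']
      ring
    have two' := fun q hq => two p q r (a+M) hr hp hq x0 η' L hx0 hx1 hη'0 hη'1 hL'
    have hrQ : r ≤ Q := by nlinarith
    have b1 : |∑ k ∈ Finset.range (a+M+1), FF p (k + x0) * T' (a + M - k)
        - ∑ k ∈ Finset.range (a+M+1), FF p (k + x0) * FF Q (L - (k + x0))|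
        ≤ ∑ k ∈ Finset.range (a+M+1), FF p (k + x0) * DD n Q c (L - (k + x0)) := by
      rw [← Finset.sum_sub_distrib]
      refine (Finset.abs_sum_le_sum_abs _ _).trans (Finset.sum_le_sum fun k hk => ?_)
      have hf : 0 ≤ FF p (k + x0) := FF_nonneg _ (by positivity)
      rw [← mul_sub, abs_mul, abs_of_nonneg hf, ← hpos k hk]
      exact mul_le_mul_of_nonneg_left (hT' _) hf
    have b2 : ∑ k ∈ Finset.range (a+M+1), FF p (k + x0) * DD n Q c (L - (k + x0))
        ≤ ∑ j ∈ Finset.range n, (n.choose (j+1) : ℝ) * c ^ (j+1) *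
      (FF (p + Q + 1 - 2 * (j+1)) L + c * FF (p + Q + 1 - 2 * (j+2)) L) := by
      unfold DD
      simp only [Finset.mul_sum]
      rw [Finset.sum_comm]
      refine Finset.sum_le_sum fun j hj => ?_
      have hj := Finset.mem_range.1 hj
      have hq : r + 2 * (j+1) ≤ Q := by nlinarith
      have t := (abs_le.1 (two' (Q - 2 * (j+1)) (by omega))).2
      have i1 : p + (Q - 2 * (j+1)) + 1 = p + Q + 1 - 2 * (j+1) := by omega
      have i2 : p + (Q - 2 * (j+1)) - 1 = p + Q + 1 - 2 * (j+2) := by omega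
      rw [i1, i2] at t
      have hcc : 0 ≤ (n.choose (j+1) : ℝ) * c ^ (j+1) := by positivity
      refine le_trans (le_of_eq ?_) (mul_le_mul_of_nonneg_left (sub_le_iff_le_add'.1 t) hcc)
      rw [Finset.mul_sum]
      refine Finset.sum_congr rfl fun k _ => ?_
      ring
    have b3 := two' Q hrQ
    rw [show p + Q - 1 = p + Q + 1 - 2 by omega] at b3
    rw [← DD_step]
    refine (abs_sub_le _ _ _).trans (add_le_add (b1.trans b2) b3)


/-- Generalized Poisson-summation estimate for
`S_m(a;ξ,r) = Σ_{a_1+⋯+a_m=a, a_i ≥ 0} ∏_i (a_i + ξ_i)^{r_i}`. -/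
theorem statement13 (m : ℕ) (hm : 2 ≤ m) (a : ℕ)
    (ξ : Fin m → ℝ) (hξ : ∀ i, ξ i ∈ Set.Icc (0 : ℝ) 1)
    (r : ℕ) (hr : 2 ≤ r) (R : Fin m → ℕ) (hR : ∀ i, r ≤ R i)
    (S : ℝ)
    (hS : S = ∑ v ∈ Finset.Nat.antidiagonalTuple m a, ∏ i, ((v i : ℝ) + ξ i) ^ (R i)) :
    |S - (∏ i, ((R i).factorial : ℝ)) / (((∑ i, R i) + m - 1).factorial : ℝ) *
        ((a : ℝ) + ∑ i, ξ i) ^ ((∑ i, R i) + m - 1)| ≤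
      (∏ i, ((R i).factorial : ℝ)) *
        ∑ j ∈ Finset.Icc 1 (m - 1),
          (Nat.choose (m - 1) j : ℝ) * (1 / (3 * ((r : ℝ) - 1))) ^ j *
            ((a : ℝ) + ∑ i, ξ i) ^ ((∑ i, R i) + m - 1 - 2 * j) /
              ((((∑ i, R i) + m - 1 - 2 * j).factorial : ℝ)) := by
  obtain ⟨n, rfl⟩ : ∃ n, m = n + 1 := ⟨m - 1, by omega⟩
  have h := main_ind r hr n ξ hξ R hR a
  have hF : (0:ℝ) < ∏ i, ((R i).factorial : ℝ) := Finset.prod_pos fun i _ => by positivity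
  have e1 : S = (∏ i, ((R i).factorial : ℝ)) * TT (n+1) a ξ R := by
    rw [hS, TT, Finset.mul_sum]
    refine Finset.sum_congr rfl fun v _ => ?_
    rw [← Finset.prod_mul_distrib]
    refine Finset.prod_congr rfl fun i _ => ?_
    have : ((R i).factorial : ℝ) ≠ 0 := by positivity
    unfold FF
    field_simp
  have i0 : (∑ i, R i) + (n + 1) - 1 = (∑ i, R i) + n := by omega
  have e2 : ∑ j ∈ Finset.Icc 1 (n + 1 - 1),
          (Nat.choose (n + 1 - 1) j : ℝ) * (1 / (3 * ((r : ℝ) - 1))) ^ j *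
            ((a : ℝ) + ∑ i, ξ i) ^ ((∑ i, R i) + (n + 1) - 1 - 2 * j) /
              ((((∑ i, R i) + (n + 1) - 1 - 2 * j).factorial : ℝ))
      = DD n ((∑ i, R i) + n) (1 / (3 * ((r:ℝ) - 1))) (a + ∑ i, ξ i) := by
    unfold DD FF
    rw [i0, Nat.add_sub_cancel, Finset.range_eq_Ico,
      Finset.sum_Ico_add' (fun j => (n.choose j : ℝ) * (1 / (3 * ((r : ℝ) - 1))) ^ j *
            (((a : ℝ) + ∑ i, ξ i) ^ ((∑ i, R i) + n - 2 * j) /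
              ((((∑ i, R i) + n - 2 * j).factorial : ℝ)))) 0 n 1]
    refine Finset.sum_congr ?_ fun j _ => by rw [mul_div_assoc]
    ext j
    simp only [Finset.mem_Icc, Finset.mem_Ico]
    omega
  rw [e2, i0, e1]
  have e3 : (∏ i, ((R i).factorial : ℝ)) * TT (n+1) a ξ R -
      (∏ i, ((R i).factorial : ℝ)) / (((∑ i, R i) + n).factorial : ℝ) *
        ((a : ℝ) + ∑ i, ξ i) ^ ((∑ i, R i) + n) =
      (∏ i, ((R i).factorial : ℝ)) *
        (TT (n+1) a ξ R - FF ((∑ i, R i) + n) (a + ∑ i, ξ i)) := by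
    unfold FF; ring
  rw [e3, abs_mul, abs_of_pos hF]
  exact mul_le_mul_of_nonneg_left h hF.le
end

section
/- Let m ≥ 2 and d ≥ 3, let D_1,…,D_m be integers with D_i ≥ d for all i, set n = D_1+…+D_m, and let a ≥ m be an integer. Define S = Σ over integers a_1,…,a_m ≥ 1 with a_1+…+a_m = a of a_m^{D_m}·∏_{j=1}^{m-1}(a_j^{D_j} - (a_j - 1)^{D_j}), so that the separation distance after an a-shuffle of the sorted deck is SEP(a) = 1 - (n!/(D_1!⋯D_m!))·a^{-n}·S. Then there exists a real number η with |η| ≤ (1 + n²/(3(d-2)(a-m+1)²))^{m-1} - 1 such that SEP(a) = 1 - (1+η)·(a^{m-1}/((n+1)(n+2)⋯(n+m-1)))·Σ_{j=0}^{m-1} (-1)^j·C(m-1, j)·(1 - j/a)^{n+m-1}. -/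
/-- Extension of a tuple `v : Fin m → ℕ` to a sequence `ℕ → ℕ` (zero beyond `m`). -/
def extNat {m : ℕ} (v : Fin m → ℕ) (j : ℕ) : ℕ :=
  if h : j < m then v ⟨j, h⟩ else 0

open intervalIntegral in
lemma beta_int (C : ℝ) (q : ℕ) : ∀ p : ℕ, ∫ x in (0:ℝ)..C, x ^ p * (C - x) ^ q =
    (p.factorial * q.factorial : ℝ) / ((p + q + 1).factorial : ℝ) * C ^ (p + q + 1) := by
  induction q with
  | zero =>
    intro p
    simp only [pow_zero, mul_one, integral_pow, Nat.factorial_succ, Nat.factorial_zero]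
    have : (p.factorial : ℝ) ≠ 0 := by positivity
    have : (p : ℝ) + 1 ≠ 0 := by positivity
    push_cast
    simp
    field_simp
  | succ q ih =>
    intro p
    have hder : ∀ x ∈ Set.uIcc (0:ℝ) C, HasDerivAt (fun x : ℝ => x ^ (p+1) * (C - x) ^ (q+1))
        (((p:ℝ)+1) * (x ^ p * (C - x) ^ (q+1)) - ((q:ℝ)+1) * (x ^ (p+1) * (C - x) ^ q)) x := by
      intro x _
      have h1 : HasDerivAt (fun x : ℝ => x ^ (p+1)) (((p+1 : ℕ):ℝ) * x ^ p) x := by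
        simpa using hasDerivAt_pow (p+1) x
      have h2 : HasDerivAt (fun x : ℝ => (C - x) ^ (q+1)) (((q+1 : ℕ):ℝ) * (C - x) ^ q * (-1)) x := by
        refine (((hasDerivAt_id x).const_sub C).pow (q+1)).congr_deriv ?_
        simp
      refine (h1.mul h2).congr_deriv ?_
      push_cast; ring
    have h := integral_eq_sub_of_hasDerivAt hder
      (Continuous.intervalIntegrable (by fun_prop) _ _)
    rw [integral_sub (Continuous.intervalIntegrable (by fun_prop) _ _)
      (Continuous.intervalIntegrable (by fun_prop) _ _), integral_const_mul, integral_const_mul,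
      ih (p+1)] at h
    simp only [sub_self, ne_eq, Nat.add_eq_zero_iff, one_ne_zero, and_false, not_false_eq_true, zero_pow, mul_zero, zero_mul, sub_zero] at h
    have e : p + 1 + q + 1 = p + (q + 1) + 1 := by ring
    rw [e] at h
    have hp : (p : ℝ) + 1 ≠ 0 := by positivity
    have : (((p + (q + 1) + 1).factorial : ℕ) : ℝ) ≠ 0 := by positivity
    apply mul_left_cancel₀ hp
    rw [sub_eq_zero.1 h, Nat.factorial_succ p, Nat.factorial_succ q]
    push_cast
    field_simp

/-- Euler–Maclaurin comparison of a lattice sum with the Beta integral. -/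
lemma base_nonneg (p q : ℕ) (t C : ℝ) (a : ℕ) (ht0 : 0 ≤ t) (ht1 : t ≤ 1) (hC : 0 ≤ C) (hCa : C ≤ a) :
    |∑ i ∈ Finset.Icc 1 a, ((i:ℝ) - t) ^ (p+2) * (max (C - ((i:ℝ) - t)) 0) ^ (q+2)
      - (∫ x in (0:ℝ)..C, x ^ (p+2) * (C - x) ^ (q+2))| ≤
    1/6 * (((p:ℝ)+2) * (∫ x in (0:ℝ)..C, x ^ p * (C - x) ^ (q+2)) +
      ((q:ℝ)+2) * (∫ x in (0:ℝ)..C, x ^ (p+2) * (C - x) ^ q)) := by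
  set f : ℝ → ℝ := fun x => x ^ (p+2) * (C - x) ^ (q+2) with hf
  set f1 : ℝ → ℝ := fun x => ((p:ℝ)+2) * (x ^ (p+1) * (C - x) ^ (q+2)) -
    ((q:ℝ)+2) * (x ^ (p+2) * (C - x) ^ (q+1)) with hf1
  set f2 : ℝ → ℝ := fun x => ((p:ℝ)+2) * ((p:ℝ)+1) * (x ^ p * (C - x) ^ (q+2)) -
    2 * ((p:ℝ)+2) * ((q:ℝ)+2) * (x ^ (p+1) * (C - x) ^ (q+1)) +
    ((q:ℝ)+2) * ((q:ℝ)+1) * (x ^ (p+2) * (C - x) ^ q) with hf2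
  set g : ℝ → ℝ := fun x => ((p:ℝ)+2) * (x ^ p * (C - x) ^ (q+2)) +
    ((q:ℝ)+2) * (x ^ (p+2) * (C - x) ^ q) with hg
  have dp : ∀ (k : ℕ) (x : ℝ), HasDerivAt (fun x : ℝ => x ^ (k+1)) (((k:ℝ)+1) * x ^ k) x := by
    intro k x
    simpa using hasDerivAt_pow (k+1) x
  have dq : ∀ (k : ℕ) (x : ℝ), HasDerivAt (fun x : ℝ => (C - x) ^ (k+1)) (-(((k:ℝ)+1) * (C - x) ^ k)) x := by
    intro k x
    refine (((hasDerivAt_id x).const_sub C).pow (k+1)).congr_deriv ?_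
    simp
  have df : ∀ x, HasDerivAt f (f1 x) x := by
    intro x
    refine ((dp (p+1) x).mul (dq (q+1) x)).congr_deriv ?_
    simp only [hf1]; push_cast; ring
  have df1 : ∀ x, HasDerivAt f1 (f2 x) x := by
    intro x
    refine ((((dp p x).mul (dq (q+1) x)).const_mul ((p:ℝ)+2)).sub
      (((dp (p+1) x).mul (dq q x)).const_mul ((q:ℝ)+2))).congr_deriv ?_
    simp only [hf2]; push_cast; ring
  have cf : Continuous f := by fun_prop
  have cg : Continuous g := by fun_prop
  set G : ℝ → ℝ := fun x => ∫ y in (0:ℝ)..x, f y with hG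
  set E : ℝ → ℝ := fun x => f1 x + 2 * ∫ y in (0:ℝ)..x, g y with hE
  have dG : ∀ x, HasDerivAt G (f x) x := fun x => cf.integral_hasStrictDerivAt 0 x |>.hasDerivAt
  have dE : ∀ x, HasDerivAt E (f2 x + 2 * g x) x := fun x =>
    (df1 x).add ((cg.integral_hasStrictDerivAt 0 x |>.hasDerivAt).const_mul 2)
  have hgn : ∀ x, 0 ≤ x → x ≤ C → 0 ≤ g x := by
    intro x h0 h1
    have : 0 ≤ C - x := by linarith
    simp only [hg]; positivity
  have hfg : ∀ x, 0 ≤ x → x ≤ C → 0 ≤ f2 x + g x := by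
    intro x h0 h1
    have h2 : 0 ≤ C - x := by linarith
    have : f2 x + g x = x ^ p * (C - x) ^ q * (((p:ℝ)+2) * (C - x) - ((q:ℝ)+2) * x) ^ 2 := by
      simp only [hf2, hg]; ring
    rw [this]; positivity
  -- cells
  set P : ℕ → ℝ := fun i => max 0 (min ((i:ℝ) - t) C) with hP
  have P0 : P 0 = 0 := by
    simp only [hP]; apply max_eq_left; apply min_le_of_left_le; simpa using ht0
  have Pl : P (a+1) = C := by
    simp only [hP]; push_cast; rw [min_eq_right (by linarith), max_eq_right hC]
  have Pn : ∀ i, 0 ≤ P i := fun i => le_max_left _ _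
  have PC : ∀ i, P i ≤ C := fun i => max_le hC (min_le_right _ _)
  have Pm : ∀ i, P i ≤ P (i+1) := by
    intro i; simp only [hP]; push_cast
    exact max_le_max le_rfl (min_le_min (by linarith) le_rfl)
  have Pcase : ∀ i, P i = (i:ℝ) - t ∨ (f (P i) = 0 ∧ f1 (P i) = 0) := by
    intro i
    have : P i = (i:ℝ) - t ∨ P i = 0 ∨ P i = C := by
      simp only [hP]
      rcases le_total ((i:ℝ) - t) C with h | h
      · rw [min_eq_left h]
        rcases le_total 0 ((i:ℝ) - t) with h' | h'
        · left; exact max_eq_right h'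
        · right; left; exact max_eq_left h'
      · rw [min_eq_right h]; right; right; exact max_eq_right hC
    rcases this with h | h | h
    · exact Or.inl h
    · right; rw [h]; simp [hf, hf1]
    · right; rw [h]; simp [hf, hf1]
  have f0 : f (P 0) = 0 := by rw [P0]; simp [hf]
  have fl : f (P (a+1)) = 0 := by rw [Pl]; simp [hf]
  have f10 : f1 (P 0) = 0 := by rw [P0]; simp [hf1]
  have f1l : f1 (P (a+1)) = 0 := by rw [Pl]; simp [hf1]
  -- interior membership
  have hin : ∀ i x, x ∈ interior (Set.Icc (P i) (P (i+1))) → (i:ℝ) - t ≤ x ∧ x ≤ (i:ℝ) + 1 - t ∧ 0 ≤ x ∧ x ≤ C := by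
    intro i x hx
    rw [interior_Icc] at hx
    obtain ⟨h1, h2⟩ := hx
    have h3 := Pn i
    have h4 := PC (i+1)
    have h5 : 0 ≤ x := by linarith
    have h6 : x ≤ C := by linarith
    simp only [hP] at h1 h2
    push_cast at h2
    refine ⟨?_, ?_, h5, h6⟩
    · by_contra hcon
      push Not at hcon
      have := (max_lt_iff.1 h1).2
      rcases min_lt_iff.1 this with h | h <;> linarith
    · rcases lt_max_iff.1 h2 with h | h
      · linarith
      · have := (lt_min_iff.1 h).1; linarith
  have key : ∀ σ : ℝ, |σ| ≤ 1 → ∀ i : ℕ,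
      E (P i) / 12 + σ * (f1 (P i) / 12 + f (P i) / 2 + G (P i)) ≤
      E (P (i+1)) / 12 + σ * (f1 (P (i+1)) / 12 - f (P (i+1)) / 2 + G (P (i+1))) := by
    intro σ hσ i
    set c : ℝ := (i:ℝ) - t with hc
    set W : ℝ → ℝ := fun x => E x / 12 + σ * (((x - c)^2 - (x - c) + 1/6) / 2 * f1 x - (x - c - 1/2) * f x + G x) with hW
    have dW : ∀ x, HasDerivAt W ((f2 x + 2 * g x) / 12 + σ * (((x - c)^2 - (x - c) + 1/6) / 2 * f2 x)) x := by
      intro x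
      have hx : HasDerivAt (fun x : ℝ => x - c) 1 x := (hasDerivAt_id x).sub_const c
      have hb : HasDerivAt (fun x : ℝ => ((x - c)^2 - (x - c) + 1/6) / 2) ((x - c) - 1/2) x := by
        refine ((((hx.pow 2).sub hx).add_const (1/6)).div_const 2).congr_deriv ?_
        simp; ring
      have hl : HasDerivAt (fun x : ℝ => (x - c - 1/2)) 1 x := hx.sub_const _
      refine (((dE x).div_const 12).add ((((hb.mul (df1 x)).sub (hl.mul (df x))).add (dG x)).const_mul σ)).congr_deriv ?_
      ring
    have hmono : MonotoneOn W (Set.Icc (P i) (P (i+1))) := by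
      apply monotoneOn_of_deriv_nonneg (convex_Icc _ _)
      · exact fun x _ => (dW x).continuousAt.continuousWithinAt
      · exact fun x _ => (dW x).differentiableAt.differentiableWithinAt
      · intro x hx
        rw [(dW x).deriv]
        obtain ⟨h1, h2, h3, h4⟩ := hin i x hx
        have hg0 := hgn x h3 h4
        have hfg0 := hfg x h3 h4
        have hu0 : 0 ≤ x - c := by linarith
        have hu1 : x - c ≤ 1 := by linarith
        have hB : |σ * ((x - c)^2 - (x - c) + 1/6)| ≤ 1/6 := by
          rw [abs_mul]
          have : |(x - c)^2 - (x - c) + 1/6| ≤ 1/6 := by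
            rw [abs_le]; constructor <;> nlinarith [sq_nonneg (x - c - 1/2)]
          calc _ ≤ 1 * (1/6 : ℝ) := mul_le_mul hσ this (abs_nonneg _) zero_le_one
            _ = _ := by ring
        obtain ⟨b1, b2⟩ := abs_le.1 hB
        set b := σ * ((x - c)^2 - (x - c) + 1/6)
        have e : (f2 x + 2 * g x) / 12 + σ * (((x - c)^2 - (x - c) + 1/6) / 2 * f2 x) =
          (1/6 + b) / 2 * (f2 x + g x) + (1/6 - b)/2 * g x := by simp only [b]; ring
        rw [e]
        have := mul_nonneg (by linarith : 0 ≤ (1/6 + b) / 2) hfg0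
        have := mul_nonneg (by linarith : 0 ≤ (1/6 - b) / 2) hg0
        linarith
    have h := hmono (Set.left_mem_Icc.2 (Pm i)) (Set.right_mem_Icc.2 (Pm i)) (Pm i)
    have e1 : W (P i) = E (P i) / 12 + σ * (f1 (P i) / 12 + f (P i) / 2 + G (P i)) := by
      simp only [hW]
      rcases Pcase i with h | ⟨h, h'⟩
      · rw [h, ← hc]; ring
      · rw [h, h']; ring
    have e2 : W (P (i+1)) = E (P (i+1)) / 12 + σ * (f1 (P (i+1)) / 12 - f (P (i+1)) / 2 + G (P (i+1))) := by
      simp only [hW]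
      rcases Pcase (i+1) with h | ⟨h, h'⟩
      · have : P (i+1) - c = 1 := by rw [h, hc]; push_cast; ring
        rw [this]; ring
      · rw [h, h']; ring
    rw [e1, e2] at h
    exact h
  -- summation
  have hsumf : ∑ i ∈ Finset.Icc 1 a, ((i:ℝ) - t) ^ (p+2) * (max (C - ((i:ℝ) - t)) 0) ^ (q+2)
      = ∑ i ∈ Finset.range (a+1), f (P (i+1)) := by
    rw [Finset.sum_range_succ, fl, add_zero, Finset.range_eq_Ico, Finset.sum_Ico_add' (fun i => f (P i)) 0 a 1]
    apply Finset.sum_congr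
    · ext i; simp
    · intro i hi
      have hi1 : (1:ℝ) ≤ i := by
        have := (Finset.mem_Ico.1 hi).1
        exact_mod_cast (by omega : 1 ≤ i)
      simp only [hP]
      rcases le_total ((i:ℝ) - t) C with h | h
      · rw [min_eq_left h, max_eq_right (by linarith : 0 ≤ (i:ℝ) - t), max_eq_left (by linarith)]
      · rw [min_eq_right h, max_eq_right hC, max_eq_right (by linarith : C - ((i:ℝ) - t) ≤ 0)]
        simp [hf]
  have hsumf' : ∑ i ∈ Finset.range (a+1), f (P i) = ∑ i ∈ Finset.range (a+1), f (P (i+1)) := by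
    have h1 := Finset.sum_range_succ (fun i => f (P i)) (a+1)
    have h2 := Finset.sum_range_succ' (fun i => f (P i)) (a+1)
    rw [h1] at h2
    simp only [fl, f0] at h2
    linarith
  have tot : ∀ σ : ℝ, |σ| ≤ 1 → 0 ≤ (E C - E 0) / 12 + σ * (G C - G 0 - ∑ i ∈ Finset.range (a+1), f (P (i+1))) := by
    intro σ hσ
    have h := Finset.sum_nonneg (fun i (_ : i ∈ Finset.range (a+1)) => sub_nonneg.2 (key σ hσ i))
    have e : ∀ i, E (P (i+1)) / 12 + σ * (f1 (P (i+1)) / 12 - f (P (i+1)) / 2 + G (P (i+1))) -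
      (E (P i) / 12 + σ * (f1 (P i) / 12 + f (P i) / 2 + G (P i))) =
      ((E (P (i+1)) / 12 + σ * (f1 (P (i+1)) / 12 + G (P (i+1)))) - (E (P i) / 12 + σ * (f1 (P i) / 12 + G (P i))))
       - σ / 2 * f (P (i+1)) - σ / 2 * f (P i) := by intro i; ring
    simp only [e] at h
    rw [Finset.sum_sub_distrib, Finset.sum_sub_distrib, ← Finset.mul_sum, ← Finset.mul_sum, hsumf',
      Finset.sum_range_sub (fun i => E (P i) / 12 + σ * (f1 (P i) / 12 + G (P i))), f10, f1l, P0, Pl] at h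
    linarith
  have G0 : G 0 = 0 := by simp [hG]
  have hEE : E C - E 0 = 2 * (((p:ℝ)+2) * (∫ x in (0:ℝ)..C, x ^ p * (C - x) ^ (q+2)) +
      ((q:ℝ)+2) * (∫ x in (0:ℝ)..C, x ^ (p+2) * (C - x) ^ q)) := by
    simp only [hE, hg]
    rw [P0] at f10
    rw [Pl] at f1l
    rw [f10, f1l, intervalIntegral.integral_add (Continuous.intervalIntegrable (by fun_prop) _ _)
      (Continuous.intervalIntegrable (by fun_prop) _ _), intervalIntegral.integral_const_mul, intervalIntegral.integral_const_mul]
    simp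
  have t1 := tot 1 (by simp)
  have t2 := tot (-1) (by simp)
  rw [G0, hEE] at t1 t2
  rw [hsumf]
  change |_ - G C| ≤ _
  rw [abs_le]
  constructor <;> linarith

lemma base (d r s : ℕ) (hd : 3 ≤ d) (hr : d ≤ r + 1) (hs : d ≤ s) (t C : ℝ) (a : ℕ)
    (ht0 : 0 ≤ t) (ht1 : t ≤ 1) (hCa : C ≤ a) :
    |∑ i ∈ Finset.Icc 1 a, ((i:ℝ) - t) ^ r * (max (C - ((i:ℝ) - t)) 0) ^ s
      - (r.factorial * s.factorial : ℝ) / ((r + s + 1).factorial : ℝ) * (max C 0) ^ (r + s + 1)| ≤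
    (r.factorial * s.factorial : ℝ) / ((r + s - 1).factorial : ℝ) / (3 * ((d:ℝ) - 2)) *
      (max C 0) ^ (r + s - 1) := by
  obtain ⟨p, rfl⟩ : ∃ p, r = p + 2 := ⟨r - 2, by omega⟩
  obtain ⟨q, rfl⟩ : ∃ q, s = q + 2 := ⟨s - 2, by omega⟩
  have hd' : (3:ℝ) ≤ d := by exact_mod_cast hd
  have hr' : (d:ℝ) ≤ p + 3 := by exact_mod_cast hr
  have hs' : (d:ℝ) ≤ q + 2 := by exact_mod_cast hs
  rcases le_total 0 C with hC | hC
  · have h := base_nonneg p q t C a ht0 ht1 hC hCa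
    rw [beta_int, beta_int, beta_int] at h
    rw [max_eq_left hC]
    refine h.trans ?_
    have e1 : p + (q + 2) + 1 = p + 2 + (q + 2) - 1 := by omega
    have e2 : p + 2 + q + 1 = p + 2 + (q + 2) - 1 := by omega
    rw [e1, e2]
    set F : ℝ := ((p + 2 + (q + 2) - 1).factorial : ℝ)
    have hF : 0 < F := by simp only [F]; positivity
    have key : 1/6 * (((p:ℝ)+2) * ((p.factorial * (q+2).factorial : ℝ) / F) + ((q:ℝ)+2) * (((p+2).factorial * q.factorial : ℝ) / F))
       ≤ ((p+2).factorial * (q+2).factorial : ℝ) / F / (3 * ((d:ℝ) - 2)) := by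
      have hd2 : 0 < (d:ℝ) - 2 := by linarith
      rw [Nat.factorial_succ (p+1), Nat.factorial_succ p, Nat.factorial_succ (q+1), Nat.factorial_succ q]
      push_cast
      have hX : (0:ℝ) < (p:ℝ) + 1 := by positivity
      have hY : (0:ℝ) < (q:ℝ) + 1 := by positivity
      have h1 : 1 / ((p:ℝ)+1) ≤ 1 / ((d:ℝ) - 2) := one_div_le_one_div_of_le hd2 (by linarith)
      have h2 : 1 / ((q:ℝ)+1) ≤ 1 / ((d:ℝ) - 2) := one_div_le_one_div_of_le hd2 (by linarith)
      have hK : 0 ≤ (((p:ℝ)+2) * ((p:ℝ)+1) * p.factorial * (((q:ℝ)+2) * ((q:ℝ)+1) * q.factorial)) / F / 6 := by positivity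
      calc _ = (((p:ℝ)+2) * ((p:ℝ)+1) * p.factorial * (((q:ℝ)+2) * ((q:ℝ)+1) * q.factorial)) / F / 6 * (1 / ((p:ℝ)+1) + 1 / ((q:ℝ)+1)) := by
            field_simp; ring
        _ ≤ (((p:ℝ)+2) * ((p:ℝ)+1) * p.factorial * (((q:ℝ)+2) * ((q:ℝ)+1) * q.factorial)) / F / 6 * (1 / ((d:ℝ) - 2) + 1 / ((d:ℝ) - 2)) := by
            gcongr
        _ = _ := by field_simp; ring
    have := mul_le_mul_of_nonneg_right key (pow_nonneg hC (p + 2 + (q + 2) - 1))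
    refine le_trans (le_of_eq ?_) this
    ring
  · have hz : ∑ i ∈ Finset.Icc 1 a, ((i:ℝ) - t) ^ (p+2) * (max (C - ((i:ℝ) - t)) 0) ^ (q+2) = 0 := by
      apply Finset.sum_eq_zero
      intro i hi
      have : (1:ℝ) ≤ i := by exact_mod_cast (Finset.mem_Icc.1 hi).1
      rw [max_eq_right (by linarith)]; simp
    rw [hz, max_eq_right hC]; simp

/-- `Wf k s x` is the integral of `(x - Σ t)_+ ^ s` over the unit cube of dimension `k`. -/
noncomputable def Wf : ℕ → ℕ → ℝ → ℝ
  | 0, s, x => (max x 0) ^ s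
  | k+1, s, x => ∫ t in (0:ℝ)..1, Wf k s (x - t)

lemma Wf_cont (k s : ℕ) : Continuous (Wf k s) := by
  induction k with
  | zero =>
    change Continuous (fun x : ℝ => (max x 0) ^ s)
    fun_prop
  | succ k ih =>
    change Continuous (fun x : ℝ => ∫ t in (0:ℝ)..1, Wf k s (x - t))
    apply intervalIntegral.continuous_parametric_intervalIntegral_of_continuous'
    exact ih.comp (continuous_fst.sub continuous_snd)

lemma Wf_nonneg (k s : ℕ) (x : ℝ) : 0 ≤ Wf k s x := by
  induction k generalizing x with
  | zero => unfold Wf; positivity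
  | succ k ih =>
    unfold Wf
    exact intervalIntegral.integral_nonneg zero_le_one (fun t _ => ih _)

lemma Wf_ratio (k s : ℕ) (x : ℝ) (hx : (k:ℝ) ≤ x) :
    (x - k) ^ 2 * Wf k s x ≤ Wf k (s+2) x := by
  induction k generalizing x with
  | zero =>
    have h : 0 ≤ x := by simpa using hx
    unfold Wf
    rw [max_eq_left h]
    apply le_of_eq
    push_cast; ring
  | succ k ih =>
    have hk := Wf_cont k s
    have hk2 := Wf_cont k (s+2)
    unfold Wf
    rw [← intervalIntegral.integral_const_mul]
    apply intervalIntegral.integral_mono_on zero_le_one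
      (Continuous.intervalIntegrable (by fun_prop) _ _) (Continuous.intervalIntegrable (by fun_prop) _ _)
    intro t ht
    push_cast at hx ⊢
    refine le_trans ?_ (ih (x - t) (by linarith [ht.2]))
    apply mul_le_mul_of_nonneg_right _ (Wf_nonneg _ _ _)
    apply pow_le_pow_left₀ <;> linarith [ht.2]

lemma int_abs_le (f g : ℝ → ℝ) (hf : Continuous f) (hg : Continuous g)
    (h : ∀ t ∈ Set.Icc (0:ℝ) 1, |f t| ≤ g t) : |∫ t in (0:ℝ)..1, f t| ≤ ∫ t in (0:ℝ)..1, g t := by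
  refine (intervalIntegral.abs_integral_le_integral_abs zero_le_one).trans ?_
  apply intervalIntegral.integral_mono_on zero_le_one
      (Continuous.intervalIntegrable (by fun_prop) _ _) (Continuous.intervalIntegrable (by fun_prop) _ _)
  exact h

lemma stepQ (d r s : ℕ) (hd : 3 ≤ d) (hr : d ≤ r + 1) (hs : d ≤ s) (t : ℝ) (a : ℕ)
    (ht0 : 0 ≤ t) (ht1 : t ≤ 1) (l : ℕ) : ∀ C : ℝ, C ≤ a →
    |∑ i ∈ Finset.Icc 1 a, ((i:ℝ) - t) ^ r * Wf l s (C - ((i:ℝ) - t))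
      - (r.factorial * s.factorial : ℝ) / ((r + s + 1).factorial : ℝ) * Wf l (r + s + 1) C| ≤
    (r.factorial * s.factorial : ℝ) / ((r + s - 1).factorial : ℝ) / (3 * ((d:ℝ) - 2)) *
      Wf l (r + s - 1) C := by
  induction l with
  | zero => intro C hC; exact base d r s hd hr hs t C a ht0 ht1 hC
  | succ l ih =>
    intro C hC
    have c1 := Wf_cont l s
    have c2 := Wf_cont l (r + s + 1)
    have c3 := Wf_cont l (r + s - 1)
    have h := int_abs_le
      (fun u => ∑ i ∈ Finset.Icc 1 a, ((i:ℝ) - t) ^ r * Wf l s ((C - u) - ((i:ℝ) - t))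
        - (r.factorial * s.factorial : ℝ) / ((r + s + 1).factorial : ℝ) * Wf l (r + s + 1) (C - u))
      (fun u => (r.factorial * s.factorial : ℝ) / ((r + s - 1).factorial : ℝ) / (3 * ((d:ℝ) - 2)) *
        Wf l (r + s - 1) (C - u)) (by fun_prop) (by fun_prop)
      (fun u hu => ih (C - u) (by linarith [hu.1]))
    rw [intervalIntegral.integral_sub (Continuous.intervalIntegrable (by fun_prop) _ _)
      (Continuous.intervalIntegrable (by fun_prop) _ _), intervalIntegral.integral_finsetSum
      (fun i _ => Continuous.intervalIntegrable (by fun_prop) _ _)] at h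
    simp only [intervalIntegral.integral_const_mul] at h
    have e : ∀ (i : ℕ) (u : ℝ), C - u - ((i:ℝ) - t) = C - ((i:ℝ) - t) - u := by intros; ring
    simp only [e] at h
    exact h

lemma pow_diff (r : ℕ) (i : ℝ) : ((r:ℝ) + 1) * ∫ t in (0:ℝ)..1, (i - t) ^ r = i ^ (r+1) - (i - 1) ^ (r+1) := by
  rw [intervalIntegral.integral_comp_sub_left (fun x => x ^ r) i, integral_pow]
  have : (r:ℝ) + 1 ≠ 0 := by positivity
  field_simp
  simp

lemma stepW (d E s : ℕ) (hd : 3 ≤ d) (hE : d ≤ E) (hs : d ≤ s) (a : ℕ) (l : ℕ) (A : ℝ) (hA : A ≤ a) :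
    |∑ i ∈ Finset.Icc 1 a, ((i:ℝ) ^ E - ((i:ℝ) - 1) ^ E) * Wf l s (A - i)
      - (E.factorial * s.factorial : ℝ) / ((E + s).factorial : ℝ) * Wf (l+1) (E + s) A| ≤
    (E.factorial * s.factorial : ℝ) / ((E + s - 2).factorial : ℝ) / (3 * ((d:ℝ) - 2)) *
      Wf (l+1) (E + s - 2) A := by
  obtain ⟨r, rfl⟩ : ∃ r, E = r + 1 := ⟨E - 1, by omega⟩
  have c2 := Wf_cont l (r + s + 1)
  have c3 := Wf_cont l (r + s - 1)
  have h := int_abs_le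
      (fun t => ∑ i ∈ Finset.Icc 1 a, ((i:ℝ) - t) ^ r * Wf l s (A - i)
        - (r.factorial * s.factorial : ℝ) / ((r + s + 1).factorial : ℝ) * Wf l (r + s + 1) (A - t))
      (fun t => (r.factorial * s.factorial : ℝ) / ((r + s - 1).factorial : ℝ) / (3 * ((d:ℝ) - 2)) *
        Wf l (r + s - 1) (A - t)) (by fun_prop) (by fun_prop)
      (fun t ht => by
        have := stepQ d r s hd hE hs t a ht.1 ht.2 l (A - t) (by linarith [ht.1])
        have e : ∀ i : ℕ, A - t - ((i:ℝ) - t) = A - i := by intros; ring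
        simp only [e] at this
        exact this)
  rw [intervalIntegral.integral_sub (Continuous.intervalIntegrable (by fun_prop) _ _)
      (Continuous.intervalIntegrable (by fun_prop) _ _), intervalIntegral.integral_finsetSum
      (fun i _ => Continuous.intervalIntegrable (by fun_prop) _ _)] at h
  simp only [intervalIntegral.integral_const_mul, intervalIntegral.integral_mul_const] at h
  have hr : (0:ℝ) ≤ (r:ℝ) + 1 := by positivity
  have h2 := mul_le_mul_of_nonneg_left h hr
  rw [← abs_of_nonneg hr, ← abs_mul, abs_of_nonneg hr, mul_sub, Finset.mul_sum] at h2
  simp only [← mul_assoc, pow_diff] at h2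
  have e1 : r + 1 + s = r + s + 1 := by ring
  have e2 : r + s + 1 - 2 = r + s - 1 := by omega
  rw [e1, e2, Nat.factorial_succ r]
  change |_ - _ * (∫ t in (0:ℝ)..1, Wf l (r + s + 1) (A - t))| ≤
    _ * (∫ t in (0:ℝ)..1, Wf l (r + s - 1) (A - t))
  push_cast
  refine le_trans (le_of_eq ?_) (h2.trans (le_of_eq ?_))
  · congr 2
    ring
  · ring

/-- Iterated discrete convolution with the weights `i ^ D - (i-1) ^ D`. -/
noncomputable def Lf (a : ℕ) : ℕ → (ℕ → ℕ) → (ℝ → ℝ) → ℝ → ℝ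
  | 0, _, g, x => g x
  | k+1, D, g, x => ∑ i ∈ Finset.Icc 1 a, ((i:ℝ) ^ (D 0) - ((i:ℝ) - 1) ^ (D 0)) *
      Lf a k (fun j => D (j+1)) g (x - i)

lemma Lf_peel (a k : ℕ) : ∀ (D : ℕ → ℕ) (g : ℝ → ℝ) (x : ℝ), Lf a (k+1) D g x =
    Lf a k D (fun y => ∑ i ∈ Finset.Icc 1 a, ((i:ℝ) ^ (D k) - ((i:ℝ) - 1) ^ (D k)) * g (y - i)) x := by
  induction k with
  | zero => intro D g x; simp [Lf]
  | succ k ih =>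
    intro D g x
    change (∑ i ∈ Finset.Icc 1 a, ((i:ℝ) ^ (D 0) - ((i:ℝ) - 1) ^ (D 0)) *
      Lf a (k+1) (fun j => D (j+1)) g (x - i)) = _
    rw [Finset.sum_congr rfl (fun i _ => by rw [ih])]
    rfl

lemma wt_nonneg (a E i : ℕ) (hi : i ∈ Finset.Icc 1 a) : (0:ℝ) ≤ (i:ℝ) ^ E - ((i:ℝ) - 1) ^ E := by
  have : (1:ℝ) ≤ i := by exact_mod_cast (Finset.mem_Icc.1 hi).1
  rw [sub_nonneg]
  apply pow_le_pow_left₀ <;> linarith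

lemma Lf_lin (a k : ℕ) : ∀ (D : ℕ → ℕ) (g h : ℝ → ℝ) (b c : ℝ) (x : ℝ),
    Lf a k D (fun y => b * g y + c * h y) x = b * Lf a k D g x + c * Lf a k D h x := by
  induction k with
  | zero => intro D g h b c x; simp [Lf]
  | succ k ih =>
    intro D g h b c x
    simp only [Lf, ih]
    rw [Finset.mul_sum, Finset.mul_sum, ← Finset.sum_add_distrib]
    apply Finset.sum_congr rfl; intro i _; ring

lemma Lf_mono (a k : ℕ) : ∀ (D : ℕ → ℕ) (g h : ℝ → ℝ) (x : ℝ), x ≤ a → (∀ y : ℝ, y ≤ a → g y ≤ h y) →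
    Lf a k D g x ≤ Lf a k D h x := by
  induction k with
  | zero => intro D g h x hx hgh; exact hgh x hx
  | succ k ih =>
    intro D g h x hx hgh
    simp only [Lf]
    apply Finset.sum_le_sum
    intro i hi
    apply mul_le_mul_of_nonneg_left _ (wt_nonneg a _ i hi)
    apply ih _ _ _ _ _ hgh
    have : (0:ℝ) ≤ i := by positivity
    linarith

lemma Lf_abs (a k : ℕ) (D : ℕ → ℕ) (f g h : ℝ → ℝ) (b c : ℝ) (x : ℝ) (hx : x ≤ a)
    (H : ∀ y : ℝ, y ≤ a → |f y - b * g y| ≤ c * h y) :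
    |Lf a k D f x - b * Lf a k D g x| ≤ c * Lf a k D h x := by
  have h1 := Lf_mono a k D f (fun y => b * g y + c * h y) x hx
    (fun y hy => by have := (abs_le.1 (H y hy)).2; linarith)
  have h2 := Lf_mono a k D (fun y => b * g y + (-c) * h y) f x hx
    (fun y hy => by have := (abs_le.1 (H y hy)).1; linarith)
  rw [Lf_lin] at h1 h2
  rw [abs_le]; constructor <;> linarith

lemma main_ind_s14 (a d n K : ℕ) (hd : 3 ≤ d) (haK : K + 1 ≤ a) (D : ℕ → ℕ) (k : ℕ) :
    (∀ i < k, d ≤ D i) → ∀ l s : ℕ, k + l = K → d ≤ s → (∑ i ∈ Finset.range k, D i) + s ≤ n →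
    |Lf a k D (Wf l s) a - (∏ i ∈ Finset.range k, ((D i).factorial : ℝ)) * s.factorial /
        (((∑ i ∈ Finset.range k, D i) + s).factorial : ℝ) * Wf K ((∑ i ∈ Finset.range k, D i) + s) a| ≤
      ((1 + (n:ℝ)^2 / (3 * ((d:ℝ) - 2) * ((a:ℝ) - K)^2)) ^ k - 1) *
      ((∏ i ∈ Finset.range k, ((D i).factorial : ℝ)) * s.factorial /
        (((∑ i ∈ Finset.range k, D i) + s).factorial : ℝ) * Wf K ((∑ i ∈ Finset.range k, D i) + s) a) := by
  have hd' : (3:ℝ) ≤ d := by exact_mod_cast hd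
  have haK' : (K:ℝ) + 1 ≤ a := by exact_mod_cast haK
  set ε : ℝ := (n:ℝ)^2 / (3 * ((d:ℝ) - 2) * ((a:ℝ) - K)^2) with hε
  have hd2 : 0 < (d:ℝ) - 2 := by linarith
  have haK2 : 0 < (a:ℝ) - K := by linarith
  have hε0 : 0 ≤ ε := by positivity
  induction k with
  | zero =>
    intro _ l s hl hs hn
    have : l = K := by omega
    subst this
    have h0 : ((s.factorial : ℕ) : ℝ) ≠ 0 := by positivity
    simp [Lf, h0]
  | succ k ih =>
    intro hD l s hl hs hn
    have hDk := hD k (by omega)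
    have hD' : ∀ i < k, d ≤ D i := fun i hi => hD i (by omega)
    set Sk := ∑ i ∈ Finset.range k, D i with hSk
    set Pk := ∏ i ∈ Finset.range k, ((D i).factorial : ℝ) with hPk
    have hPpos : 0 < Pk := Finset.prod_pos (fun i _ => by positivity)
    rw [Finset.sum_range_succ, ← hSk] at hn ⊢
    rw [Finset.prod_range_succ, ← hPk]
    have i1 := ih hD' (l+1) (D k + s) (by omega) (by omega) (by omega)
    have i2 := ih hD' (l+1) (D k + s - 2) (by omega) (by omega) (by omega)
    have hL := Lf_abs a k D _ _ _ _ _ a le_rfl (fun y hy => stepW d (D k) s hd hDk hs a l y hy)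
    rw [← Lf_peel] at hL
    obtain ⟨N, hN⟩ : ∃ N, Sk + D k + s = N + 2 := ⟨Sk + D k + s - 2, by omega⟩
    have e1 : Sk + (D k + s) = N + 2 := by omega
    have e2 : Sk + (D k + s - 2) = N := by omega
    rw [e1] at i1
    rw [e2] at i2
    rw [hN] at hn ⊢
    set L1 := Lf a k D (Wf (l+1) (D k + s)) a
    set L2 := Lf a k D (Wf (l+1) (D k + s - 2)) a
    set L0 := Lf a (k+1) D (Wf l s) a
    set V := Wf K (N+2) a
    set V' := Wf K N a
    have hV : ((a:ℝ) - K)^2 * V' ≤ V := Wf_ratio K N a (by linarith)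
    have hV'0 : 0 ≤ V' := Wf_nonneg _ _ _
    have F1 : (0:ℝ) < (D k + s).factorial := by positivity
    have F2 : (0:ℝ) < (D k + s - 2).factorial := by positivity
    have F3 : (0:ℝ) < (D k).factorial := by positivity
    have F4 : (0:ℝ) < s.factorial := by positivity
    have F5 : (0:ℝ) < N.factorial := by positivity
    have F6 : (0:ℝ) < (N+2).factorial := by positivity
    have F65 : ((N+2).factorial : ℝ) = ((N:ℝ)+2) * ((N:ℝ)+1) * N.factorial := by
      rw [Nat.factorial_succ, Nat.factorial_succ]; push_cast; ring
    set c : ℝ := Pk * (D k).factorial * s.factorial / (N+2).factorial with hc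
    have hc0 : 0 < c := by positivity
    set b : ℝ := ((D k).factorial * s.factorial : ℝ) / ((D k + s).factorial : ℝ) with hb
    have hb0 : 0 < b := by positivity
    set κ : ℝ := ((D k).factorial * s.factorial : ℝ) / ((D k + s - 2).factorial : ℝ) / (3 * ((d:ℝ) - 2)) with hκ
    have hκ0 : 0 < κ := by positivity
    have j1 : |b * L1 - c * V| ≤ ((1 + ε)^k - 1) * (c * V) := by
      have := mul_le_mul_of_nonneg_left i1 hb0.le
      rw [← abs_of_nonneg hb0.le, ← abs_mul, abs_of_nonneg hb0.le] at this
      have e : c = b * (Pk * (D k + s).factorial / (N+2).factorial) := by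
        rw [hc, hb]; field_simp
      rw [e]
      refine le_trans (le_of_eq ?_) (this.trans (le_of_eq ?_))
      · congr 1; ring
      · ring
    have j2 : κ * L2 ≤ (1 + ε)^k * (ε * (c * V)) := by
      have h1 := (abs_le.1 i2).2
      have h2 : L2 ≤ (1 + ε)^k * (Pk * (D k + s - 2).factorial / N.factorial * V') := by linarith
      have h3 := mul_le_mul_of_nonneg_left h2 hκ0.le
      refine h3.trans ?_
      rw [mul_left_comm]
      apply mul_le_mul_of_nonneg_left _ (by positivity)
      have e : κ * (Pk * (D k + s - 2).factorial / N.factorial * V') =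
          c * ((((N:ℝ)+2) * ((N:ℝ)+1)) / (3 * ((d:ℝ) - 2) * ((a:ℝ) - K)^2) * (((a:ℝ) - K)^2 * V')) := by
        rw [hκ, hc, F65]; field_simp
      rw [e, mul_left_comm ε c V]
      apply mul_le_mul_of_nonneg_left _ hc0.le
      apply mul_le_mul _ hV (by positivity) hε0
      rw [hε]
      apply div_le_div_of_nonneg_right _ (by positivity)
      have hn' : (N:ℝ) + 2 ≤ n := by exact_mod_cast hn
      have : (0:ℝ) ≤ N := by positivity
      nlinarith
    calc |L0 - c * V| = |(L0 - b * L1) + (b * L1 - c * V)| := by ring_nf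
      _ ≤ |L0 - b * L1| + |b * L1 - c * V| := abs_add_le _ _
      _ ≤ (1 + ε)^k * (ε * (c * V)) + ((1 + ε)^k - 1) * (c * V) := add_le_add (hL.trans j2) j1
      _ = _ := by ring


lemma int_pos_pow (s : ℕ) (hs : 1 ≤ s) (x : ℝ) : ((s:ℝ) + 1) * ∫ t in (0:ℝ)..1, (max (x - t) 0) ^ s =
    (max x 0) ^ (s+1) - (max (x-1) 0) ^ (s+1) := by
  rw [intervalIntegral.integral_comp_sub_left (fun y => (max y 0) ^ s) x, sub_zero,
    ← intervalIntegral.integral_const_mul]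
  apply intervalIntegral.integral_eq_sub_of_hasDeriv_right
    (f := fun y : ℝ => (max y 0) ^ (s+1)) (f' := fun y : ℝ => ((s:ℝ)+1) * (max y 0) ^ s)
  · exact Continuous.continuousOn (by fun_prop)
  · intro y _
    rcases lt_or_ge y 0 with h | h
    · have h0 : HasDerivAt (fun _ : ℝ => (0:ℝ)) 0 y := hasDerivAt_const _ _
      have : HasDerivAt (fun y : ℝ => (max y 0) ^ (s+1)) 0 y := by
        refine h0.congr_of_eventuallyEq ?_
        filter_upwards [eventually_lt_nhds h] with z hz
        rw [max_eq_right hz.le]; simp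
      have e : ((s:ℝ)+1) * (max y 0) ^ s = 0 := by
        rw [max_eq_right h.le, zero_pow (by omega), mul_zero]
      rw [e]
      exact this.hasDerivWithinAt
    · have h0 : HasDerivAt (fun z : ℝ => z ^ (s+1)) (((s:ℝ)+1) * y ^ s) y := by
        simpa using hasDerivAt_pow (s+1) y
      rw [max_eq_left h]
      refine h0.hasDerivWithinAt.congr ?_ ?_
      · intro z hz
        have : y < z := hz
        rw [max_eq_left (by linarith)]
      · rw [max_eq_left h]
  · exact Continuous.intervalIntegrable (by fun_prop) _ _

lemma Wf_rec (s : ℕ) (hs : 1 ≤ s) (k : ℕ) : ∀ (x : ℝ),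
    ((s:ℝ) + 1) * Wf (k+1) s x = Wf k (s+1) x - Wf k (s+1) (x-1) := by
  induction k with
  | zero => intro x; exact int_pos_pow s hs x
  | succ k ih =>
    intro x
    have c1 := Wf_cont k (s+1)
    change ((s:ℝ) + 1) * (∫ t in (0:ℝ)..1, Wf (k+1) s (x - t)) =
      (∫ t in (0:ℝ)..1, Wf k (s+1) (x - t)) - (∫ t in (0:ℝ)..1, Wf k (s+1) (x - 1 - t))
    rw [← intervalIntegral.integral_const_mul,
      ← intervalIntegral.integral_sub (Continuous.intervalIntegrable (by fun_prop) _ _)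
      (Continuous.intervalIntegrable (by fun_prop) _ _)]
    simp only [ih]
    have e : ∀ t : ℝ, x - t - 1 = x - 1 - t := by intro t; ring
    simp only [e]

lemma alt_pascal (k : ℕ) (φ : ℕ → ℝ) :
    ∑ j ∈ Finset.range (k+2), (-1:ℝ)^j * ((k+1).choose j : ℝ) * φ j =
    ∑ j ∈ Finset.range (k+1), (-1:ℝ)^j * (k.choose j : ℝ) * (φ j - φ (j+1)) := by
  have h1 : ∑ j ∈ Finset.range (k+2), (-1:ℝ)^j * (k.choose j : ℝ) * φ j =
      ∑ j ∈ Finset.range (k+1), (-1:ℝ)^j * (k.choose j : ℝ) * φ j := by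
    rw [Finset.sum_range_succ]; simp
  rw [Finset.sum_range_succ'] at h1 ⊢
  have h2 : ∑ j ∈ Finset.range (k+1), (-1:ℝ)^(j+1) * ((k+1).choose (j+1) : ℝ) * φ (j+1) =
      ∑ j ∈ Finset.range (k+1), (-1:ℝ)^(j+1) * (k.choose (j+1) : ℝ) * φ (j+1)
      - ∑ j ∈ Finset.range (k+1), (-1:ℝ)^j * (k.choose j : ℝ) * φ (j+1) := by
    rw [← Finset.sum_sub_distrib]
    apply Finset.sum_congr rfl
    intro j _
    rw [Nat.choose_succ_succ]; push_cast; ring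
  simp only [mul_sub, Finset.sum_sub_distrib]
  rw [h2, ← h1]
  simp
  ring

lemma Wf_explicit (k : ℕ) : ∀ (s : ℕ) (x : ℝ), 1 ≤ s → Wf k s x =
    (s.factorial : ℝ) / ((s + k).factorial : ℝ) *
      ∑ j ∈ Finset.range (k+1), (-1:ℝ)^j * (k.choose j : ℝ) * (max (x - j) 0) ^ (s + k) := by
  induction k with
  | zero =>
    intro s x _
    have h0 : ((s.factorial : ℕ) : ℝ) ≠ 0 := by positivity
    simp [Wf, h0]
  | succ k ih =>
    intro s x hs
    have h := Wf_rec s hs k x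
    rw [ih (s+1) x (by omega), ih (s+1) (x-1) (by omega), ← mul_sub, ← Finset.sum_sub_distrib] at h
    rw [alt_pascal]
    have hs0 : (s:ℝ) + 1 ≠ 0 := by positivity
    apply mul_left_cancel₀ hs0
    rw [h, Nat.factorial_succ s]
    have e : s + 1 + k = s + (k + 1) := by ring
    rw [e]
    push_cast
    rw [← mul_assoc, ← mul_div_assoc]
    congr 1
    apply Finset.sum_congr rfl
    intro j _
    have e2 : x - 1 - (j:ℝ) = x - (j + 1) := by ring
    rw [e2]; ring

lemma Lf_zero (a k : ℕ) : ∀ (D : ℕ → ℕ) (s : ℕ) (x : ℝ), 1 ≤ s → x ≤ 0 → Lf a k D (Wf 0 s) x = 0 := by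
  induction k with
  | zero =>
    intro D s x hs hx
    simp only [Lf, Wf]
    rw [max_eq_right hx, zero_pow (by omega)]
  | succ k ih =>
    intro D s x hs hx
    simp only [Lf]
    apply Finset.sum_eq_zero
    intro i _
    have : (0:ℝ) ≤ i := by positivity
    rw [ih _ s _ hs (by linarith), mul_zero]

lemma extNat_cons_zero {k : ℕ} (i : ℕ) (w : Fin k → ℕ) : extNat (Fin.cons i w : Fin (k+1) → ℕ) 0 = i := by
  simp [extNat]

lemma extNat_cons_succ {k : ℕ} (i : ℕ) (w : Fin k → ℕ) (j : ℕ) :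
    extNat (Fin.cons i w : Fin (k+1) → ℕ) (j+1) = extNat w j := by
  unfold extNat
  by_cases h : j < k
  · rw [dif_pos h, dif_pos (by omega)]
    exact Fin.cons_succ (α := fun _ => ℕ) i w ⟨j, h⟩
  · rw [dif_neg h, dif_neg (by omega)]

lemma S_eq (a : ℕ) (k : ℕ) : ∀ (D : ℕ → ℕ) (b : ℕ), 1 ≤ D k → b ≤ a →
    ((∑ v ∈ (Finset.Nat.antidiagonalTuple (k+1) b).filter (fun v => ∀ i, 1 ≤ v i),
      (extNat v k) ^ (D k) *
        ∏ j ∈ Finset.range k, ((extNat v j) ^ (D j) - (extNat v j - 1) ^ (D j)) : ℕ) : ℝ) =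
    Lf a k D (Wf 0 (D k)) b := by
  induction k with
  | zero =>
    intro D b hD hb
    rw [Finset.sum_filter, Finset.Nat.antidiagonalTuple_one, Finset.sum_singleton]
    simp only [Lf, Wf]
    rcases Nat.eq_zero_or_pos b with rfl | h
    · have : D 0 ≠ 0 := by omega
      simp [this]
    · have h' : 1 ≤ b := h
      simp [extNat, h']
  | succ k ih =>
    intro D b hD hb
    simp only [Lf]
    rw [← Finset.sum_fiberwise_of_maps_to (t := Finset.Icc 1 a) (g := fun v : Fin (k+2) → ℕ => v 0)]
    · push_cast
      apply Finset.sum_congr rfl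
      intro i hi
      obtain ⟨hi1, hia⟩ := Finset.mem_Icc.1 hi
      rcases Nat.lt_or_ge b i with hbi | hbi
      · have hx : (b:ℝ) - i ≤ 0 := by
          have : (b:ℝ) < i := by exact_mod_cast hbi
          linarith
        rw [Lf_zero a k _ _ _ hD hx, mul_zero]
        apply Finset.sum_eq_zero
        intro v hv
        exfalso
        simp only [Finset.mem_filter, Finset.Nat.mem_antidiagonalTuple] at hv
        have : v 0 ≤ b := le_trans (Finset.single_le_sum (f := v) (fun _ _ => Nat.zero_le _) (Finset.mem_univ 0)) (le_of_eq hv.1.1)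
        omega
      · have ih' := ih (fun j => D (j+1)) (b - i) hD (by omega)
        rw [Nat.cast_sub hbi] at ih'
        rw [← ih']
        push_cast
        rw [Finset.mul_sum]
        refine Finset.sum_nbij' (fun v => Fin.tail v) (fun w => (Fin.cons i w : Fin (k+2) → ℕ)) ?_ ?_ ?_ ?_ ?_
        · intro v hv
          simp only [Finset.mem_filter, Finset.Nat.mem_antidiagonalTuple] at hv ⊢
          obtain ⟨⟨h1, h2⟩, h3⟩ := hv
          rw [Fin.sum_univ_succ] at h1
          refine ⟨?_, fun j => h2 j.succ⟩
          simp only [Fin.tail]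
          omega
        · intro w hw
          simp only [Finset.mem_filter, Finset.Nat.mem_antidiagonalTuple] at hw ⊢
          refine ⟨⟨?_, ?_⟩, by simp⟩
          · rw [Fin.sum_univ_succ]
            simp only [Fin.cons_zero, Fin.cons_succ]
            omega
          · intro j
            refine Fin.cases ?_ ?_ j
            · simpa using hi1
            · intro j; simpa using hw.2 j
        · intro v hv
          simp only [Finset.mem_filter] at hv
          rw [← hv.2]
          exact Fin.cons_self_tail v
        · intro w _
          exact Fin.tail_cons (α := fun _ => ℕ) i w
        · intro v hv
          simp only [Finset.mem_filter] at hv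
          obtain ⟨w, rfl⟩ : ∃ w : Fin (k+1) → ℕ, v = Fin.cons i w :=
            ⟨Fin.tail v, by rw [← hv.2]; exact (Fin.cons_self_tail v).symm⟩
          have ht : Fin.tail (Fin.cons i w : Fin (k+2) → ℕ) = w := Fin.tail_cons (α := fun _ => ℕ) i w
          rw [ht, Finset.prod_range_succ']
          simp only [extNat_cons_zero, extNat_cons_succ]
          have hle : (i - 1) ^ D 0 ≤ i ^ D 0 := Nat.pow_le_pow_left (by omega) _
          rw [Nat.cast_sub hle]
          push_cast [hi1]
          ring
    · intro v hv
      simp only [Finset.mem_filter, Finset.Nat.mem_antidiagonalTuple] at hv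
      have : v 0 ≤ b := le_trans (Finset.single_le_sum (f := v) (fun _ _ => Nat.zero_le _) (Finset.mem_univ 0)) (le_of_eq hv.1)
      have := hv.2 0
      rw [Finset.mem_Icc]
      omega

/-- Rule of thumb: with `S` counting shuffle words producing the reversed pattern
(so `SEP(a) = 1 - (n!/(D_1!⋯D_m!))·a^{-n}·S`), there is `η` with
`|η| ≤ (1 + n²/(3(d-2)(a-m+1)²))^{m-1} - 1` such that
`SEP(a) = 1 - (1+η)·(a^{m-1}/((n+1)⋯(n+m-1)))·Σ_{j=0}^{m-1} (-1)^j C(m-1,j)(1-j/a)^{n+m-1}`.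
(Here `D` is 0-indexed: `D i` is the paper's `D_{i+1}`.) -/
theorem statement14 (m d : ℕ) (hm : 2 ≤ m) (hd : 3 ≤ d)
    (D : ℕ → ℕ) (hD : ∀ i < m, d ≤ D i)
    (n : ℕ) (hn : n = ∑ i ∈ Finset.range m, D i)
    (a : ℕ) (ha : m ≤ a)
    (S : ℕ)
    (hS : S = ∑ v ∈ (Finset.Nat.antidiagonalTuple m a).filter fun v => ∀ i, 1 ≤ v i,
      (extNat v (m - 1)) ^ (D (m - 1)) *
        ∏ j ∈ Finset.range (m - 1), ((extNat v j) ^ (D j) - (extNat v j - 1) ^ (D j)))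
    (SEP : ℝ)
    (hSEP : SEP = 1 - (n.factorial : ℝ) / (∏ i ∈ Finset.range m, ((D i).factorial : ℝ)) *
      ((S : ℝ) / (a : ℝ) ^ n)) :
    ∃ η : ℝ,
      |η| ≤ (1 + (n : ℝ) ^ 2 / (3 * ((d : ℝ) - 2) * ((a : ℝ) - (m : ℝ) + 1) ^ 2)) ^ (m - 1) - 1 ∧
      SEP = 1 - (1 + η) *
        ((a : ℝ) ^ (m - 1) / ∏ j ∈ Finset.range (m - 1), ((n : ℝ) + 1 + (j : ℝ))) *
        ∑ j ∈ Finset.range m,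
          (-1 : ℝ) ^ j * (Nat.choose (m - 1) j : ℝ) * (1 - (j : ℝ) / (a : ℝ)) ^ (n + m - 1) := by
  obtain ⟨K, rfl⟩ : ∃ K, m = K + 1 := ⟨m - 1, by omega⟩
  simp only [Nat.add_sub_cancel] at hS ⊢
  have hd' : (3:ℝ) ≤ d := by exact_mod_cast hd
  have hd2 : 0 < (d:ℝ) - 2 := by linarith
  have hDK := hD K (by omega)
  have hSL : (S:ℝ) = Lf a K D (Wf 0 (D K)) a := by
    rw [hS]; exact S_eq a K D a (by omega) le_rfl
  have hnK : n = (∑ i ∈ Finset.range K, D i) + D K := by rw [hn, Finset.sum_range_succ]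
  have hmain := main_ind_s14 a d n K hd ha D K (fun i hi => hD i (by omega)) 0 (D K) (by omega) hDK hnK.ge
  rw [← hnK, ← hSL, ← Finset.prod_range_succ (fun i => ((D i).factorial : ℝ))] at hmain
  set P : ℝ := ∏ i ∈ Finset.range (K+1), ((D i).factorial : ℝ) with hP
  have hPpos : 0 < P := Finset.prod_pos (fun i _ => by positivity)
  have hnf : (0:ℝ) < n.factorial := by positivity
  have ea : (a:ℝ) - ((K + 1 : ℕ) : ℝ) + 1 = a - K := by push_cast; ring
  rw [ea]
  set ε : ℝ := (n : ℝ) ^ 2 / (3 * ((d : ℝ) - 2) * ((a : ℝ) - K) ^ 2) with hε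
  have hε0 : 0 ≤ ε := by positivity
  have hB : 0 ≤ (1 + ε) ^ K - 1 := by
    have := one_le_pow₀ (n := K) (by linarith : 1 ≤ 1 + ε)
    linarith
  set X : ℝ := P / n.factorial * Wf K n a with hX
  have hX0 : 0 ≤ X := mul_nonneg (by positivity) (Wf_nonneg _ _ _)
  have ha0 : (0:ℝ) < a := by exact_mod_cast (by omega : 0 < a)
  have hfac : ((n + K).factorial : ℝ) = n.factorial * ∏ j ∈ Finset.range K, ((n : ℝ) + 1 + (j : ℝ)) := by
    clear * -
    induction K with
    | zero => simp
    | succ K ih =>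
      rw [Finset.prod_range_succ, ← mul_assoc, ← ih, ← add_assoc, Nat.factorial_succ]
      push_cast; ring
  have hW : Wf K n a = (a:ℝ)^n * (((a : ℝ) ^ K / ∏ j ∈ Finset.range K, ((n : ℝ) + 1 + (j : ℝ))) *
        ∑ j ∈ Finset.range (K+1),
          (-1 : ℝ) ^ j * (Nat.choose K j : ℝ) * (1 - (j : ℝ) / (a : ℝ)) ^ (n + K)) := by
    rw [Wf_explicit K n a (by omega), hfac]
    have hprod : (∏ j ∈ Finset.range K, ((n : ℝ) + 1 + (j : ℝ))) ≠ 0 := by positivity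
    have : ∑ j ∈ Finset.range (K+1), (-1:ℝ)^j * (K.choose j : ℝ) * (max ((a:ℝ) - j) 0) ^ (n + K) =
       (a:ℝ)^(n+K) * ∑ j ∈ Finset.range (K+1),
          (-1 : ℝ) ^ j * (Nat.choose K j : ℝ) * (1 - (j : ℝ) / (a : ℝ)) ^ (n + K) := by
      rw [Finset.mul_sum]
      apply Finset.sum_congr rfl
      intro j hj
      have hj' : (j:ℝ) ≤ a := by
        have := Finset.mem_range.1 hj
        exact_mod_cast (by omega : j ≤ a)
      rw [max_eq_left (by linarith)]
      have : (a:ℝ) - j = a * (1 - j / a) := by field_simp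
      rw [this, mul_pow]; ring
    rw [this, pow_add]
    field_simp
  have e3 : n + (K + 1) - 1 = n + K := by omega
  rw [e3]
  have hsep : ∀ η : ℝ, (S:ℝ) = (1 + η) * X → SEP = 1 - (1 + η) *
        ((a : ℝ) ^ K / ∏ j ∈ Finset.range K, ((n : ℝ) + 1 + (j : ℝ))) *
        ∑ j ∈ Finset.range (K+1),
          (-1 : ℝ) ^ j * (Nat.choose K j : ℝ) * (1 - (j : ℝ) / (a : ℝ)) ^ (n + K) := by
    intro η h
    rw [hSEP, h, hX, hW, mul_assoc (1 + η)]
    field_simp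
  rcases hX0.eq_or_lt with h0 | hpos
  · refine ⟨0, by simpa using hB, hsep 0 ?_⟩
    have hm' : |(S:ℝ) - X| ≤ ((1 + ε) ^ K - 1) * X := hmain
    rw [← h0] at hm' ⊢
    simpa using hm'
  · refine ⟨(S - X) / X, ?_, hsep _ (by field_simp; ring)⟩
    rw [abs_div, abs_of_pos hpos, div_le_iff₀ hpos]
    exact hmain
end

section
/- Let n ≥ 3 and a ≥ 2 be integers, set α = 1 - 1/a, and define SEP(a) = 1 - (C(2n, n)/a^{2n})·Σ_{k=1}^{a-1} (a-k)^n·(k^n - (k-1)^n). Then there exists a real number θ ∈ [-1,1] such that SEP(a) = 1 - (a/(2n+1))·(1 - α^{2n+1}) + (2θ/(3a))·(n/(n-2))·(1 - α^{2n-1}). -/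
open intervalIntegral

/-- `h m x = x^m - (x-1)_+^m`. -/
noncomputable def hh (m : ℕ) (x : ℝ) : ℝ := x ^ m - (max (x - 1) 0) ^ m

lemma hh_cont (m : ℕ) : Continuous (hh m) := by
  unfold hh; fun_prop

lemma hasDerivAt_posPow (m : ℕ) (x : ℝ) :
    HasDerivAt (fun y : ℝ => (max y 0) ^ (m + 2)) (((m : ℝ) + 2) * (max x 0) ^ (m + 1)) x := by
  have hp : ∀ y : ℝ, HasDerivAt (fun y : ℝ => y ^ (m + 2)) (((m : ℝ) + 2) * y ^ (m + 1)) y := by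
    intro y
    have := hasDerivAt_pow (m + 2) y
    refine HasDerivAt.congr_deriv this ?_
    push_cast; norm_num
  have hz : ∀ y : ℝ, HasDerivAt (fun _ : ℝ => (0 : ℝ)) 0 y := fun y => hasDerivAt_const y 0
  rcases lt_trichotomy x 0 with h | h | h
  · rw [max_eq_right h.le]
    have : HasDerivAt (fun _ : ℝ => (0 : ℝ)) (((m : ℝ) + 2) * 0 ^ (m + 1)) x := by
      simpa using hz x
    refine this.congr_of_eventuallyEq ?_
    filter_upwards [eventually_lt_nhds h] with y hy
    rw [max_eq_right hy.le]; simp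
  · subst h
    have h1 : HasDerivWithinAt (fun y : ℝ => (max y 0) ^ (m + 2))
        (((m : ℝ) + 2) * (max (0:ℝ) 0) ^ (m + 1)) (Set.Iic 0) 0 := by
      have : HasDerivWithinAt (fun _ : ℝ => (0 : ℝ)) (((m : ℝ) + 2) * (max (0:ℝ) 0) ^ (m + 1))
          (Set.Iic 0) 0 := by simpa using (hz 0).hasDerivWithinAt
      refine this.congr ?_ ?_
      · intro y hy
        rw [max_eq_right hy]; simp
      · simp
    have h2 : HasDerivWithinAt (fun y : ℝ => (max y 0) ^ (m + 2))
        (((m : ℝ) + 2) * (max (0:ℝ) 0) ^ (m + 1)) (Set.Ici 0) 0 := by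
      have : HasDerivWithinAt (fun y : ℝ => y ^ (m + 2)) (((m : ℝ) + 2) * (max (0:ℝ) 0) ^ (m + 1))
          (Set.Ici 0) 0 := by simpa using (hp 0).hasDerivWithinAt
      refine this.congr ?_ ?_
      · intro y hy
        rw [max_eq_left hy]
      · simp
    have h3 := h1.union h2
    rw [Set.Iic_union_Ici] at h3
    exact hasDerivWithinAt_univ.mp h3
  · rw [max_eq_left h.le]
    refine (hp x).congr_of_eventuallyEq ?_
    filter_upwards [eventually_gt_nhds h] with y hy
    rw [max_eq_left hy.le]

lemma hh_deriv (m : ℕ) (x : ℝ) : HasDerivAt (hh (m + 2)) (((m : ℝ) + 2) * hh (m + 1) x) x := by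
  have h1 : HasDerivAt (fun y : ℝ => y ^ (m + 2)) (((m : ℝ) + 2) * x ^ (m + 1)) x := by
    have := hasDerivAt_pow (m + 2) x
    refine HasDerivAt.congr_deriv this ?_
    push_cast; norm_num
  have h2 := (hasDerivAt_posPow m (x - 1)).comp_sub_const x 1
  have := h1.sub h2
  unfold hh
  refine HasDerivAt.congr_deriv this ?_
  ring

/-- integration by parts on one unit interval -/
lemma trap_one (f fd fdd : ℝ → ℝ) (hf : ∀ x, HasDerivAt f (fd x) x)
    (hfp : ∀ x, HasDerivAt fd (fdd x) x) (hc : Continuous fdd) (k : ℝ) :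
    ∫ x in k..(k + 1), ((x - k) * (k + 1 - x) / 2 * fdd x) =
      (f k + f (k + 1)) / 2 - ∫ x in k..(k + 1), f x := by
  have cf : Continuous f := continuous_iff_continuousAt.2 fun x => (hf x).continuousAt
  have key : ∫ x in k..(k + 1), ((x - k) * (k + 1 - x) / 2 * fdd x + f x) =
      (fun x => (x - k) * (k + 1 - x) / 2 * fd x - (k + 1 / 2 - x) * f x) (k + 1) -
      (fun x => (x - k) * (k + 1 - x) / 2 * fd x - (k + 1 / 2 - x) * f x) k := by
    refine integral_eq_sub_of_hasDerivAt (f := fun x => (x - k) * (k + 1 - x) / 2 * fd x - (k + 1 / 2 - x) * f x) ?_ ?_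
    · intro x _
      have hK : HasDerivAt (fun x : ℝ => (x - k) * (k + 1 - x) / 2) (k + 1 / 2 - x) x := by
        have := (((hasDerivAt_id x).sub_const k).mul ((hasDerivAt_id x).const_sub (k + 1))).div_const 2
        refine HasDerivAt.congr_deriv this ?_
        simp <;> ring
      have hKp : HasDerivAt (fun x : ℝ => (k + 1 / 2 - x)) (-1) x :=
        (hasDerivAt_id x).const_sub _
      have := (hK.mul (hfp x)).sub (hKp.mul (hf x))
      refine HasDerivAt.congr_deriv this ?_
      ring
    · exact Continuous.intervalIntegrable (by fun_prop) _ _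
  rw [integral_add (Continuous.intervalIntegrable (by fun_prop) _ _)
    (Continuous.intervalIntegrable (by fun_prop) _ _)] at key
  simp only at key
  linarith [key, (by ring : (k + 1 - k) * (k + 1 - (k + 1)) / 2 * fd (k + 1) - (k + 1 / 2 - (k + 1)) * f (k + 1) -
    ((k - k) * (k + 1 - k) / 2 * fd k - (k + 1 / 2 - k) * f k) = (f k + f (k + 1)) / 2)]

lemma trap_s15 (f fd fdd E : ℝ → ℝ) (hf : ∀ x, HasDerivAt f (fd x) x)
    (hfp : ∀ x, HasDerivAt fd (fdd x) x) (hc : Continuous fdd) (hE : Continuous E) (a : ℕ)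
    (hE0 : ∀ x : ℝ, 0 ≤ x → x ≤ a → 0 ≤ E x) (hD : ∀ x : ℝ, 0 ≤ x → x ≤ a → 0 ≤ fdd x + E x)
    (h0 : fd 0 = 0) (ha : fd a = 0) :
    |∑ k ∈ Finset.range a, (f k + f (k + 1)) / 2 - ∫ x in (0:ℝ)..a, f x| ≤
      1 / 8 * ∫ x in (0:ℝ)..a, E x := by
  have cf : Continuous f := continuous_iff_continuousAt.2 fun x => (hf x).continuousAt
  have split : ∀ g : ℝ → ℝ, Continuous g →
      ∑ k ∈ Finset.range a, ∫ x in (k:ℝ)..((k:ℝ) + 1), g x = ∫ x in (0:ℝ)..a, g x := by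
    intro g hg
    have := sum_integral_adjacent_intervals (f := g) (μ := MeasureTheory.volume)
      (a := fun k : ℕ => (k : ℝ)) (n := a) (fun k _ => hg.intervalIntegrable _ _)
    simpa using this
  have e1 : ∑ k ∈ Finset.range a, (f k + f (k + 1)) / 2 - ∫ x in (0:ℝ)..a, f x =
      ∑ k ∈ Finset.range a, ∫ x in (k:ℝ)..((k:ℝ) + 1), ((x - k) * (k + 1 - x) / 2 * fdd x) := by
    rw [← split f cf, ← Finset.sum_sub_distrib]
    exact Finset.sum_congr rfl fun k _ => (trap_one f fd fdd hf hfp hc k).symm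
  have hI : ∫ x in (0:ℝ)..a, fdd x = 0 := by
    rw [integral_eq_sub_of_hasDerivAt (fun x _ => hfp x) (hc.intervalIntegrable _ _), h0, ha]; simp
  have hIK : ∫ x in (0:ℝ)..a, (fdd x + E x) = ∫ x in (0:ℝ)..a, E x := by
    rw [integral_add (hc.intervalIntegrable _ _) (hE.intervalIntegrable _ _), hI, zero_add]
  rw [e1, abs_le]
  have hk : ∀ k ∈ Finset.range a, ∀ x ∈ Set.Icc (k:ℝ) (k + 1),
      0 ≤ x ∧ x ≤ a ∧ 0 ≤ (x - k) * (k + 1 - x) / 2 ∧ (x - k) * (k + 1 - x) / 2 ≤ 1 / 8 := by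
    intro k hk x hx
    have h1 : ((k + 1 : ℕ) : ℝ) ≤ a := by exact_mod_cast Finset.mem_range.1 hk
    push_cast at h1
    have h2 : (0:ℝ) ≤ k := Nat.cast_nonneg k
    refine ⟨by linarith [hx.1], by linarith [hx.2], ?_, ?_⟩
    · have := mul_nonneg (sub_nonneg.2 hx.1) (sub_nonneg.2 hx.2)
      linarith
    · nlinarith [sq_nonneg (x - k - 1 / 2)]
  constructor
  · rw [← split E hE, Finset.mul_sum, ← Finset.sum_neg_distrib]
    refine Finset.sum_le_sum fun k hkk => ?_
    rw [← integral_const_mul, ← integral_neg]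
    refine integral_mono_on (by linarith) (Continuous.intervalIntegrable (by fun_prop) _ _)
      (Continuous.intervalIntegrable (by fun_prop) _ _) fun x hx => ?_
    obtain ⟨h1, h2, h3, h4⟩ := hk k hkk x hx
    have := mul_nonneg h3 (hD x h1 h2)
    have := mul_nonneg (sub_nonneg.2 h4) (hE0 x h1 h2)
    nlinarith
  · rw [← hIK, ← split (fun x => fdd x + E x) (by fun_prop), Finset.mul_sum]
    refine Finset.sum_le_sum fun k hkk => ?_
    rw [← integral_const_mul]
    refine integral_mono_on (by linarith) (Continuous.intervalIntegrable (by fun_prop) _ _)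
      (Continuous.intervalIntegrable (by fun_prop) _ _) fun x hx => ?_
    obtain ⟨h1, h2, h3, h4⟩ := hk k hkk x hx
    have := mul_nonneg h3 (hE0 x h1 h2)
    have := mul_nonneg (sub_nonneg.2 h4) (hD x h1 h2)
    nlinarith

lemma beta_nat (L : ℝ) (p : ℕ) : ∀ q : ℕ, ∫ x in (0:ℝ)..L, (L - x) ^ p * x ^ q =
    (p.factorial * q.factorial : ℝ) / (p + q + 1).factorial * L ^ (p + q + 1) := by
  induction p with
  | zero =>
    intro q
    simp only [pow_zero, one_mul, integral_pow, zero_add, Nat.factorial_succ, Nat.factorial_zero]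
    have := Nat.factorial_ne_zero q
    push_cast
    field_simp
    simp
  | succ p ih =>
    intro q
    have h := integral_eq_sub_of_hasDerivAt (a := (0:ℝ)) (b := L)
      (f := fun x : ℝ => (L - x) ^ (p + 1) * x ^ (q + 1))
      (f' := fun x : ℝ => ((q:ℝ) + 1) * ((L - x) ^ (p + 1) * x ^ q)
        - ((p:ℝ) + 1) * ((L - x) ^ p * x ^ (q + 1)))
      (fun x _ => by
        have := (((hasDerivAt_id x).const_sub L).pow (p + 1)).mul ((hasDerivAt_id x).pow (q + 1))
        refine HasDerivAt.congr_deriv this ?_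
        simp <;> ring)
      (Continuous.intervalIntegrable (by fun_prop) _ _)
    rw [integral_sub (Continuous.intervalIntegrable (by fun_prop) _ _)
      (Continuous.intervalIntegrable (by fun_prop) _ _), integral_const_mul, integral_const_mul,
      ih (q + 1)] at h
    simp only [sub_self, ne_eq, Nat.add_eq_zero_iff, one_ne_zero, and_false, not_false_eq_true,
      zero_pow, zero_mul, mul_zero] at h
    have hq : ((q:ℝ) + 1) ≠ 0 := by positivity
    apply mul_left_cancel₀ hq
    rw [sub_eq_zero.1 h, (by ring : p + 1 + q + 1 = p + (q + 1) + 1), Nat.factorial_succ p,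
      Nat.factorial_succ q]
    push_cast
    ring

lemma J_int (a : ℝ) (ha : 1 ≤ a) (p m : ℕ) : ∫ x in (0:ℝ)..a, (a - x) ^ p * hh (m + 1) x =
    (p.factorial * (m + 1).factorial : ℝ) / (p + (m + 1) + 1).factorial *
      (a ^ (p + (m + 1) + 1) - (a - 1) ^ (p + (m + 1) + 1)) := by
  have e : ∀ x : ℝ, (a - x) ^ p * hh (m + 1) x =
      (a - x) ^ p * x ^ (m + 1) - (a - x) ^ p * (max (x - 1) 0) ^ (m + 1) := by
    intro x; unfold hh; ring
  simp_rw [e]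
  rw [integral_sub (Continuous.intervalIntegrable (by fun_prop) _ _)
      (Continuous.intervalIntegrable (by fun_prop) _ _), beta_nat]
  have h1 : ∫ x in (0:ℝ)..a, (a - x) ^ p * (max (x - 1) 0) ^ (m + 1) =
      ∫ x in (0:ℝ)..(a - 1), (a - 1 - x) ^ p * x ^ (m + 1) := by
    rw [← integral_add_adjacent_intervals (b := 1)
      (Continuous.intervalIntegrable (by fun_prop) _ _)
      (Continuous.intervalIntegrable (by fun_prop) _ _)]
    have z : ∫ x in (0:ℝ)..1, (a - x) ^ p * (max (x - 1) 0) ^ (m + 1) = ∫ x in (0:ℝ)..1, 0 := by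
      refine integral_congr fun x hx => ?_
      rw [Set.uIcc_of_le zero_le_one] at hx
      beta_reduce
      rw [max_eq_right (by linarith [hx.2])]; simp
    have w : ∫ x in (1:ℝ)..a, (a - x) ^ p * (max (x - 1) 0) ^ (m + 1) =
        ∫ x in (1:ℝ)..a, (fun y => (a - 1 - y) ^ p * y ^ (m + 1)) (x - 1) := by
      refine integral_congr fun x hx => ?_
      rw [Set.uIcc_of_le ha] at hx
      beta_reduce
      rw [max_eq_left (by linarith [hx.1])]; ring
    rw [z, w, integral_comp_sub_right (fun y => (a - 1 - y) ^ p * y ^ (m + 1)) 1]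
    simp
  rw [h1, beta_nat]
  ring

lemma hh_nonneg (m : ℕ) (x : ℝ) (hx : 0 ≤ x) : 0 ≤ hh m x := by
  unfold hh
  have : max (x - 1) 0 ≤ x := max_le (by linarith) hx
  have := pow_le_pow_left₀ (le_max_right (x - 1) 0) this m
  linarith

lemma R_mono (j : ℕ) (A x y : ℝ) (hx : 0 ≤ x) (hxy : x ≤ y) :
    x ^ (j + 3) / (j + 3) - 2 * A * (x ^ (j + 2) / (j + 2)) + A ^ 2 * (x ^ (j + 1) / (j + 1)) ≤
    y ^ (j + 3) / (j + 3) - 2 * A * (y ^ (j + 2) / (j + 2)) + A ^ 2 * (y ^ (j + 1) / (j + 1)) := by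
  have hI : ∀ m : ℕ, ∫ t in x..y, t ^ m = y ^ (m + 1) / (m + 1) - x ^ (m + 1) / (m + 1) := by
    intro m; rw [integral_pow]; ring
  have h : 0 ≤ ∫ t in x..y, (t ^ (j + 2) - 2 * A * t ^ (j + 1) + A ^ 2 * t ^ j) := by
    refine integral_nonneg hxy fun t ht => ?_
    have : t ^ (j + 2) - 2 * A * t ^ (j + 1) + A ^ 2 * t ^ j = t ^ j * (t - A) ^ 2 := by ring
    rw [this]
    have : 0 ≤ t := hx.trans ht.1
    positivity
  rw [integral_add (Continuous.intervalIntegrable (by fun_prop) _ _)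
      (Continuous.intervalIntegrable (by fun_prop) _ _),
    integral_sub (Continuous.intervalIntegrable (by fun_prop) _ _)
      (Continuous.intervalIntegrable (by fun_prop) _ _), integral_const_mul, integral_const_mul,
      hI, hI, hI] at h
  push_cast at h
  rw [(by ring : (j:ℝ) + 2 + 1 = j + 3), (by ring : (j:ℝ) + 1 + 1 = j + 2)] at h
  nlinarith [h]

lemma main_bound (j a : ℕ) (ha : 1 ≤ a) :
    |∑ k ∈ Finset.Icc 1 (a - 1), ((a:ℝ) - k) ^ (j + 3) * ((k:ℝ) ^ (j + 3) - ((k:ℝ) - 1) ^ (j + 3)) -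
      ∫ x in (0:ℝ)..a, ((a:ℝ) - x) ^ (j + 3) * hh (j + 2 + 1) x| ≤
    1 / 8 * (2 * ((j:ℝ) + 3) * (j + 2) / (j + 1) *
      ∫ x in (0:ℝ)..a, ((a:ℝ) - x) ^ (j + 3) * hh (j + 1) x) := by
  have c1 := hh_cont (j + 1)
  have c2 := hh_cont (j + 2)
  have c3 := hh_cont (j + 3)
  set f : ℝ → ℝ := fun x => ((a:ℝ) - x) ^ (j + 3) * hh (j + 3) x with hfd
  have hA : ∀ (m : ℕ) (x : ℝ), HasDerivAt (fun x : ℝ => ((a:ℝ) - x) ^ (m + 1))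
      (-((m:ℝ) + 1) * ((a:ℝ) - x) ^ m) x := by
    intro m x
    have := ((hasDerivAt_id x).const_sub (a:ℝ)).pow (m + 1)
    refine HasDerivAt.congr_deriv this ?_
    simp <;> ring
  have h3 : ∀ x, HasDerivAt (hh (j + 3)) (((j:ℝ) + 3) * hh (j + 2) x) x := by
    intro x
    have := hh_deriv (j + 1) x
    refine HasDerivAt.congr_deriv this ?_
    push_cast; ring
  have h2 := hh_deriv j
  have T := trap_s15 f
    (fun x => ((j:ℝ) + 3) * (((a:ℝ) - x) ^ (j + 3) * hh (j + 2) x - ((a:ℝ) - x) ^ (j + 2) * hh (j + 3) x))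
    (fun x => ((j:ℝ) + 3) * ((j + 2) * (((a:ℝ) - x) ^ (j + 3) * hh (j + 1) x)
      - 2 * (j + 3) * (((a:ℝ) - x) ^ (j + 2) * hh (j + 2) x)
      + (j + 2) * (((a:ℝ) - x) ^ (j + 1) * hh (j + 3) x)))
    (fun x => 2 * ((j:ℝ) + 3) * (j + 2) / (j + 1) * (((a:ℝ) - x) ^ (j + 3) * hh (j + 1) x))
    (fun x => by
      have := (hA (j + 2) x).mul (h3 x)
      refine HasDerivAt.congr_deriv this ?_
      push_cast; ring)
    (fun x => by
      have := (((hA (j + 2) x).mul (h2 x)).sub ((hA (j + 1) x).mul (h3 x))).const_mul ((j:ℝ) + 3)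
      refine HasDerivAt.congr_deriv this ?_
      push_cast; ring)
    (by fun_prop) (by fun_prop) a
    (fun x hx hxa => by
      have := hh_nonneg (j + 1) x hx
      have : 0 ≤ (a:ℝ) - x := by linarith
      positivity)
    (fun x hx hxa => by
      have hR := R_mono j ((a:ℝ) - x) (max (x - 1) 0) x (le_max_right _ _)
        (max_le (by linarith) hx)
      have hA0 : 0 ≤ (a:ℝ) - x := by linarith
      have hc : 0 ≤ ((j:ℝ) + 2) * (j + 3) ^ 2 * ((a:ℝ) - x) ^ (j + 1) := by positivity
      have := mul_nonneg hc (sub_nonneg.2 hR)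
      refine this.trans_eq ?_
      unfold hh
      have e1 : (j:ℝ) + 1 ≠ 0 := by positivity
      have e2 : (j:ℝ) + 2 ≠ 0 := by positivity
      have e3 : (j:ℝ) + 3 ≠ 0 := by positivity
      generalize max (x - 1) 0 = y
      field_simp
      ring)
    (by simp [hh])
    (by simp)
  rw [integral_const_mul] at T
  have hs : ∑ k ∈ Finset.range a, (f k + f (k + 1)) / 2 =
      ∑ k ∈ Finset.Icc 1 (a - 1), ((a:ℝ) - k) ^ (j + 3) * ((k:ℝ) ^ (j + 3) - ((k:ℝ) - 1) ^ (j + 3)) := by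
    have f0 : f 0 = 0 := by simp [hfd, hh]
    have fa : f a = 0 := by simp [hfd]
    have g : ∀ k ∈ Finset.Icc 1 (a - 1),
        ((a:ℝ) - k) ^ (j + 3) * ((k:ℝ) ^ (j + 3) - ((k:ℝ) - 1) ^ (j + 3)) = f k := by
      intro k hk
      have : (1:ℝ) ≤ k := by exact_mod_cast (Finset.mem_Icc.1 hk).1
      simp only [hfd, hh]
      rw [max_eq_left (by linarith)]
    rw [Finset.sum_congr rfl g]
    clear_value f
    obtain ⟨b, rfl⟩ : ∃ b, a = b + 1 := ⟨a - 1, by omega⟩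
    have : ∀ b : ℕ, ∑ k ∈ Finset.range (b + 1), (f k + f (k + 1)) / 2 =
        f 0 / 2 + f ((b + 1 : ℕ) : ℝ) / 2 + ∑ k ∈ Finset.Icc 1 b, f k := by
      intro b
      induction b with
      | zero => simp <;> ring
      | succ b ih =>
        rw [Finset.sum_range_succ, ih, Finset.sum_Icc_succ_top (by omega)]
        push_cast; ring
    rw [this, f0, fa]; simp
  rw [hs] at T
  exact T

/-- Asymptotics for the separation distance of the red-black deck (`n` reds atop `n` blacks)
after an `a`-shuffle. -/
theorem statement15 (n a : ℕ) (hn : 3 ≤ n) (ha : 2 ≤ a)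
    (α : ℝ) (hα : α = 1 - 1 / (a : ℝ))
    (SEP : ℝ)
    (hSEP : SEP = 1 - ((Nat.choose (2 * n) n : ℝ) / (a : ℝ) ^ (2 * n)) *
      ∑ k ∈ Finset.Icc 1 (a - 1),
        ((a : ℝ) - (k : ℝ)) ^ n * ((k : ℝ) ^ n - ((k : ℝ) - 1) ^ n)) :
    ∃ θ : ℝ, θ ∈ Set.Icc (-1 : ℝ) 1 ∧
      SEP = 1 - ((a : ℝ) / (2 * (n : ℝ) + 1)) * (1 - α ^ (2 * n + 1)) +
        (2 * θ / (3 * (a : ℝ))) * ((n : ℝ) / ((n : ℝ) - 2)) * (1 - α ^ (2 * n - 1)) := by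
  obtain ⟨j, rfl⟩ : ∃ j, n = j + 3 := ⟨n - 3, by omega⟩
  have hB := main_bound j a (by omega)
  have ha1 : (1:ℝ) ≤ a := by exact_mod_cast (by omega : 1 ≤ a)
  have ha0 : (0:ℝ) < a := by linarith
  rw [J_int a ha1, J_int a ha1] at hB
  set S := ∑ k ∈ Finset.Icc 1 (a - 1),
    ((a:ℝ) - k) ^ (j + 3) * ((k:ℝ) ^ (j + 3) - ((k:ℝ) - 1) ^ (j + 3)) with hS
  clear_value S
  have hα0 : 0 ≤ α := by
    rw [hα, sub_nonneg, div_le_one ha0]; exact ha1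
  have hα1 : α < 1 := by
    rw [hα]; have : 0 < 1 / (a:ℝ) := by positivity
    linarith
  have hαa : (a:ℝ) - 1 = a * α := by rw [hα]; field_simp
  have hC : ((Nat.choose (2 * (j + 3)) (j + 3) : ℝ)) * ((j + 3).factorial * (j + 3).factorial) =
      (2 * (j + 3)).factorial := by
    have := Nat.choose_mul_factorial_mul_factorial (by omega : j + 3 ≤ 2 * (j + 3))
    rw [(by omega : 2 * (j + 3) - (j + 3) = j + 3)] at this
    rw [← this]; push_cast; ring
  set C : ℝ := (Nat.choose (2 * (j + 3)) (j + 3) : ℝ) with hCd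
  have hCp : 0 < C := by
    rw [hCd]; exact_mod_cast Nat.choose_pos (by omega)
  clear_value C
  have hc0 : 0 < C / (a:ℝ) ^ (2 * (j + 3)) := by positivity
  have hB2 := mul_le_mul_of_nonneg_left hB hc0.le
  rw [← abs_of_pos hc0, ← abs_mul, abs_of_pos hc0, mul_sub] at hB2
  have hf : ((j + 3).factorial : ℝ) = (j + 3) * (j + 2) * (j + 1).factorial := by
    rw [Nat.factorial_succ (j + 2), Nat.factorial_succ (j + 1)]; push_cast; ring
  have hf2 : ((2 * (j + 3)).factorial : ℝ) = (2 * j + 6) * (2 * j + 5).factorial := by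
    rw [(by ring : 2 * (j + 3) = 2 * j + 5 + 1), Nat.factorial_succ]; push_cast; ring
  have hp1 : (0:ℝ) < (j + 1).factorial := by exact_mod_cast Nat.factorial_pos _
  have hp3 : (0:ℝ) < (j + 3).factorial := by exact_mod_cast Nat.factorial_pos _
  have hp5 : (0:ℝ) < (2 * j + 5).factorial := by exact_mod_cast Nat.factorial_pos _
  have hp6 : (0:ℝ) < (2 * (j + 3)).factorial := by exact_mod_cast Nat.factorial_pos _
  have hM : C / (a:ℝ) ^ (2 * (j + 3)) * (((j + 3).factorial * (j + 2 + 1).factorial : ℝ) /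
      (j + 3 + (j + 2 + 1) + 1).factorial *
      ((a:ℝ) ^ (j + 3 + (j + 2 + 1) + 1) - ((a:ℝ) - 1) ^ (j + 3 + (j + 2 + 1) + 1))) =
      (a:ℝ) / (2 * ((j + 3 : ℕ) : ℝ) + 1) * (1 - α ^ (2 * (j + 3) + 1)) := by
    rw [hαa, (by ring : j + 3 + (j + 2 + 1) + 1 = 2 * (j + 3) + 1),
      (by ring : j + 2 + 1 = j + 3), Nat.factorial_succ (2 * (j + 3)), mul_pow]
    have : C = (2 * (j + 3)).factorial / ((j + 3).factorial * (j + 3).factorial) := by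
      rw [eq_div_iff (by positivity)]; exact hC
    rw [this]
    push_cast
    rw [pow_succ (a:ℝ) (2 * (j + 3))]
    have hap : (a:ℝ) ^ (2 * (j + 3)) ≠ 0 := by positivity
    generalize (a:ℝ) ^ (2 * (j + 3)) = P at *
    generalize α ^ (2 * (j + 3) + 1) = Q at *
    field_simp
  have hE : C / (a:ℝ) ^ (2 * (j + 3)) * (1 / 8 * (2 * ((j:ℝ) + 3) * (j + 2) / (j + 1) *
      (((j + 3).factorial * (j + 1).factorial : ℝ) / (j + 3 + (j + 1) + 1).factorial *
      ((a:ℝ) ^ (j + 3 + (j + 1) + 1) - ((a:ℝ) - 1) ^ (j + 3 + (j + 1) + 1))))) =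
      1 / (2 * a) * (((j:ℝ) + 3) / (j + 1)) * (1 - α ^ (2 * j + 5)) := by
    rw [hαa, (by ring : j + 3 + (j + 1) + 1 = 2 * j + 5), mul_pow]
    have : C = (2 * j + 6) * (2 * j + 5).factorial / ((j + 3).factorial * (j + 3).factorial) := by
      rw [eq_div_iff (by positivity), hC, hf2]
    rw [this, (by ring : 2 * (j + 3) = 2 * j + 5 + 1), pow_succ (a:ℝ) (2 * j + 5), hf]
    have hap : (a:ℝ) ^ (2 * j + 5) ≠ 0 := by positivity
    generalize (a:ℝ) ^ (2 * j + 5) = P at *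
    generalize α ^ (2 * j + 5) = Q at *
    field_simp
    ring
  rw [hM, hE] at hB2
  set M := (a:ℝ) / (2 * ((j + 3 : ℕ) : ℝ) + 1) * (1 - α ^ (2 * (j + 3) + 1)) with hMd
  clear_value M
  have hq : 0 < 1 - α ^ (2 * j + 5) := by
    have := pow_lt_one₀ hα0 hα1 (by omega : 2 * j + 5 ≠ 0)
    linarith
  rw [(by omega : 2 * (j + 3) - 1 = 2 * j + 5)]
  set q := 1 - α ^ (2 * j + 5) with hqd
  clear_value q
  have hW : 0 < 1 / (a:ℝ) * (((j:ℝ) + 3) / (j + 1)) * q := by positivity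
  have hWe : ∀ θ : ℝ, (2 * θ / (3 * (a : ℝ))) * (((j + 3 : ℕ) : ℝ) / (((j + 3 : ℕ) : ℝ) - 2)) * q =
      θ * (2 / 3 * (1 / (a:ℝ) * (((j:ℝ) + 3) / (j + 1)) * q)) := by
    intro θ
    push_cast
    rw [(by ring : (j:ℝ) + 3 - 2 = j + 1)]
    field_simp
  have hWb : 1 / (2 * (a:ℝ)) * (((j:ℝ) + 3) / (j + 1)) * q =
      1 / 2 * (1 / (a:ℝ) * (((j:ℝ) + 3) / (j + 1)) * q) := by field_simp
  rw [hWb] at hB2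
  set W := 1 / (a:ℝ) * (((j:ℝ) + 3) / (j + 1)) * q with hWd
  clear_value W
  rw [hSEP]
  set X := C / (a:ℝ) ^ (2 * (j + 3)) * S with hX
  clear_value X
  rw [abs_le] at hB2
  refine ⟨(M - X) / (2 / 3 * W), ⟨?_, ?_⟩, ?_⟩
  · rw [le_div_iff₀ (by positivity)]; linarith [hB2.2]
  · rw [div_le_iff₀ (by positivity)]; linarith [hB2.1]
  · rw [hWe, div_mul_cancel₀ _ (by positivity)]; ring
end
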